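/- Let K be a number field or a real closed field, and let {q_1, q_2} be a nonsingular pair of quadratic forms on a finite-dimensional K-vector space V. Then the following are equivalent: (a) there exists n ∈ ℕ such that the pair n×{q_1, q_2} is hyperbolic; (b) every quadratic form q ∈ Cl{q_1, q_2} has total signature 0, i.e., sgn_P(q) = 0 for every ordering P of K. -/

import Mathlib

open Module TensorProduct

structure FieldOrdering (K : Type*) [Field K] where
  carrier : Set K
  add_mem' : ∀ ⦃a b : K⦄, a ∈ carrier → b ∈ carrier → a + b ∈ carrier
  mul_mem' : ∀ ⦃a b : K⦄, a ∈ carrier → b ∈ carrier → a * b ∈ carrier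
  total' : ∀ a : K, a ≠ 0 → a ∈ carrier ∨ -a ∈ carrier
  disjoint' : ∀ a : K, a ∈ carrier → -a ∉ carrier

noncomputable def signatureAt {K V : Type*} [Field K] [AddCommGroup V] [Module K V]
    (O : FieldOrdering K) (Q : V → K) : ℤ :=
  (sSup {n : ℕ | ∃ U : Submodule K V, Module.finrank K U = n ∧
      ∀ v ∈ U, v ≠ 0 → Q v ∈ O.carrier} : ℕ) -
  (sSup {n : ℕ | ∃ U : Submodule K V, Module.finrank K U = n ∧
      ∀ v ∈ U, v ≠ 0 → -(Q v) ∈ O.carrier} : ℕ)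

def IsHyperbolicSystem {K V : Type*} [Field K] [AddCommGroup V] [Module K V] {ι : Sort*}
    (Q : ι → V → K) : Prop :=
  ∃ U W : Submodule K V, IsCompl U W ∧
    (∀ i, ∀ v ∈ U, Q i v = 0) ∧ (∀ i, ∀ v ∈ W, Q i v = 0)

def timesQ {K V : Type*} [Field K] [AddCommGroup V] [Module K V] (n : ℕ) (Q : V → K) :
    (Fin n → V) → K := fun v => ∑ j, Q (v j)

/-- A system of quadratic (symmetric bilinear) forms is nonsingular if over some field
extension `L/K` the `L`-span of the base-changed forms contains a nondegenerate form. -/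
def IsNonsingularSystem {K : Type u} {V : Type v} [Field K] [AddCommGroup V] [Module K V]
    {ι : Type*} (B : ι → LinearMap.BilinForm K V) : Prop :=
  ∃ (L : Type (max u v)) (_ : Field L) (_ : Algebra K L),
    ∃ B' ∈ Submodule.span L
      (Set.range fun i => LinearMap.BilinForm.baseChange L (B i)),
      LinearMap.BilinForm.Nondegenerate B'

/-- A field is real closed iff `-1` is not a square, every element or its negative is a
square, sums of squares are squares, and every odd-degree polynomial has a root. -/
def IsRealClosedField (K : Type*) [Field K] : Prop :=
  ¬ IsSquare (-1 : K) ∧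
  (∀ x : K, IsSquare x ∨ IsSquare (-x)) ∧
  (∀ x y : K, IsSquare x → IsSquare y → IsSquare (x + y)) ∧
  ∀ p : Polynomial K, Odd p.natDegree → ∃ x : K, p.IsRoot x


open Module TensorProduct
section WittPart
variable {L : Type*} [Field L]

def MetFam {ι : Type*} [Fintype ι] (a : ι → Lˣ) : Prop :=
  ∃ Λ : Submodule L (ι → L), Fintype.card ι ≤ 2 * finrank L Λ ∧
    ∀ x ∈ Λ, ∀ y ∈ Λ, ∑ i, (a i : L) * x i * y i = 0

lemma met_equiv {ι κ : Type*} [Fintype ι] [Fintype κ] (e : ι ≃ κ) (a : κ → Lˣ)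
    (h : MetFam (fun i => a (e i))) : MetFam a := by
  obtain ⟨Λ, h1, h2⟩ := h
  refine ⟨Λ.map (LinearEquiv.funCongrLeft L L e.symm).toLinearMap, ?_, ?_⟩
  · rw [LinearEquiv.finrank_map_eq, ← Fintype.card_congr e]; exact h1
  · rintro _ ⟨x, hx, rfl⟩ _ ⟨y, hy, rfl⟩
    rw [← h2 x hx y hy, ← e.sum_comp]
    simp [LinearEquiv.funCongrLeft]

lemma met_smul {ι : Type*} [Fintype ι] (c : Lˣ) (a : ι → Lˣ)
    (h : MetFam a) : MetFam (fun i => c * a i) := by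
  obtain ⟨Λ, h1, h2⟩ := h
  refine ⟨Λ, h1, fun x hx y hy => ?_⟩
  have := h2 x hx y hy
  calc _ = (c : L) * ∑ i, (a i : L) * x i * y i := by
        rw [Finset.mul_sum]; refine Finset.sum_congr rfl fun i _ => ?_; push_cast; ring
    _ = 0 := by rw [this, mul_zero]

lemma met_neg {ι : Type*} [Fintype ι] (a : ι → Lˣ) :
    MetFam (Sum.elim a (fun i => - a i)) := by
  let f : (ι → L) →ₗ[L] (ι ⊕ ι → L) :=
    { toFun := fun x => Sum.elim x x
      map_add' := by intro x y; ext (i | i) <;> simp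
      map_smul' := by intro c x; ext (i | i) <;> simp }
  refine ⟨LinearMap.range f, ?_, ?_⟩
  · rw [LinearMap.finrank_range_of_inj]
    · simp; omega
    · intro x y h
      ext i
      exact congrFun h (Sum.inl i)
  · rintro _ ⟨x, rfl⟩ _ ⟨y, rfl⟩
    simp [f]

lemma met_empty {ι : Type*} [Fintype ι] [IsEmpty ι] (a : ι → Lˣ) : MetFam a := by
  refine ⟨⊤, by simp, by simp⟩

lemma met_sum {ι κ : Type*} [Fintype ι] [Fintype κ] (a : ι → Lˣ) (b : κ → Lˣ)
    (ha : MetFam a) (hb : MetFam b) : MetFam (Sum.elim a b) := by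
  obtain ⟨Λ, h1, h2⟩ := ha
  obtain ⟨M, h3, h4⟩ := hb
  let f : (Λ × M) →ₗ[L] (ι ⊕ κ → L) :=
    { toFun := fun x => Sum.elim x.1.1 x.2.1
      map_add' := by intro x y; ext (i | i) <;> simp
      map_smul' := by intro c x; ext (i | i) <;> simp }
  refine ⟨LinearMap.range f, ?_, ?_⟩
  · rw [LinearMap.finrank_range_of_inj, Module.finrank_prod, Fintype.card_sum]
    · omega
    · intro x y h
      refine Prod.ext (Subtype.ext ?_) (Subtype.ext ?_)
      · ext i
        exact congrFun h (Sum.inl i)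
      · ext i
        exact congrFun h (Sum.inr i)
  · rintro _ ⟨⟨⟨x, hx⟩, ⟨x', hx'⟩⟩, rfl⟩ _ ⟨⟨⟨y, hy⟩, ⟨y', hy'⟩⟩, rfl⟩
    simp [f, h2 x hx y hy, h4 x' hx' y' hy']

/-- the diagonal form -/
def diagB {ι : Type*} [Fintype ι] (a : ι → Lˣ) : LinearMap.BilinForm L (ι → L) :=
  LinearMap.mk₂ L (fun x y => ∑ i, (a i : L) * x i * y i)
    (by intros; simp [mul_add, add_mul, Finset.sum_add_distrib])
    (by intros; simp [Finset.mul_sum]; refine Finset.sum_congr rfl fun i _ => by ring)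
    (by intros; simp [mul_add, add_mul, Finset.sum_add_distrib])
    (by intros; simp [Finset.mul_sum]; refine Finset.sum_congr rfl fun i _ => by ring)

lemma diagB_apply {ι : Type*} [Fintype ι] (a : ι → Lˣ) (x y : ι → L) :
    diagB a x y = ∑ i, (a i : L) * x i * y i := rfl

lemma diagB_symm {ι : Type*} [Fintype ι] (a : ι → Lˣ) (x y : ι → L) :
    diagB a x y = diagB a y x := by
  simp only [diagB_apply]; refine Finset.sum_congr rfl fun i _ => by ring

lemma diagB_sep {ι : Type*} [Fintype ι] (a : ι → Lˣ) (x : ι → L)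
    (h : ∀ y, diagB a x y = 0) : x = 0 := by
  classical
  ext i
  have := h (Pi.single i 1)
  rw [diagB_apply, Finset.sum_eq_single i] at this
  · simpa using this
  · intro j _ hj; simp [Pi.single_apply, hj]
  · simp

lemma diagB_nondeg {ι : Type*} [Fintype ι] (a : ι → Lˣ) : (diagB a).Nondegenerate := by
  refine ⟨fun x h => diagB_sep a x h, fun x h => diagB_sep a x fun y => ?_⟩
  rw [diagB_symm]; exact h y

lemma met_cancel {ι κ : Type*} [Fintype ι] [Fintype κ] (a : ι → Lˣ) (b : κ → Lˣ)
    (hab : MetFam (Sum.elim a b)) (hb : MetFam b) : MetFam a := by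
  obtain ⟨Λ, h1, h2⟩ := hab
  obtain ⟨M, h3, h4⟩ := hb
  let r1 : (ι ⊕ κ → L) →ₗ[L] (ι → L) := LinearMap.funLeft L L Sum.inl
  let r2 : (ι ⊕ κ → L) →ₗ[L] (κ → L) := LinearMap.funLeft L L Sum.inr
  have e1 : ∀ x y, diagB (Sum.elim a b) x y = diagB a (r1 x) (r1 y) + diagB b (r2 x) (r2 y) := by
    intro x y; simp [diagB_apply, r1, r2, LinearMap.funLeft]
  let W2 := M.comap r2
  let P := Λ ⊓ W2
  have hP : finrank L (P.map r1) + finrank L (P ⊓ LinearMap.ker r1 : Submodule L _) = finrank L P := by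
    have := LinearMap.finrank_range_add_finrank_ker (r1.domRestrict P)
    rw [LinearMap.range_domRestrict] at this
    rw [← this, add_right_inj, LinearMap.ker_domRestrict]
    rw [← Submodule.finrank_map_subtype_eq P, Submodule.map_comap_subtype]
  have hW2 : finrank L W2 = Fintype.card ι + finrank L M := by
    have := LinearMap.finrank_range_add_finrank_ker (r2.domRestrict W2)
    rw [LinearMap.range_domRestrict, Submodule.map_comap_eq_of_surjective] at this
    swap
    · exact LinearMap.funLeft_surjective_of_injective _ _ _ Sum.inr_injective
    rw [← this, add_comm, add_left_inj, LinearMap.ker_domRestrict]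
    rw [← Submodule.finrank_map_subtype_eq W2, Submodule.map_comap_subtype]
    have h5 : W2 ⊓ LinearMap.ker r2 = LinearMap.ker r2 := by
      apply inf_eq_right.2
      intro x hx
      simp only [W2, Submodule.mem_comap]
      rw [LinearMap.mem_ker.1 hx]; exact M.zero_mem
    rw [h5]
    have h6 := LinearMap.finrank_range_add_finrank_ker r2
    rw [LinearMap.range_eq_top.2 (LinearMap.funLeft_surjective_of_injective _ _ _ Sum.inr_injective)] at h6
    simp at h6
    omega
  have hN : finrank L (Λ ⊔ W2 : Submodule L _) + finrank L (P ⊓ LinearMap.ker r1 : Submodule L _)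
      ≤ Fintype.card ι + Fintype.card κ := by
    have h7 := LinearMap.BilinForm.finrank_orthogonal (diagB_nondeg (Sum.elim a b)) (P ⊓ LinearMap.ker r1)
    have h8 : Λ ⊔ W2 ≤ (diagB (Sum.elim a b)).orthogonal (P ⊓ LinearMap.ker r1) := by
      refine sup_le ?_ ?_
      · intro x hx n hn
        exact h2 n hn.1.1 x hx
      · intro x hx n hn
        change diagB _ _ _ = 0
        rw [e1, LinearMap.mem_ker.1 hn.2]
        simp only [map_zero, LinearMap.zero_apply, zero_add]
        exact h4 _ hn.1.2 _ hx
    have h9 := Submodule.finrank_mono h8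
    rw [h7] at h9
    have h10 := Submodule.finrank_le (P ⊓ LinearMap.ker r1)
    simp at h9 h10
    omega
  have hs := Submodule.finrank_sup_add_finrank_inf_eq Λ W2
  refine ⟨P.map r1, ?_, ?_⟩
  · simp at h1
    change _ + finrank L P = _ at hs
    omega
  · rintro _ ⟨x, hx, rfl⟩ _ ⟨y, hy, rfl⟩
    have h5 := h2 x hx.1 y hy.1
    change diagB _ _ _ = 0 at h5
    rw [e1] at h5
    have h6 : diagB b (r2 x) (r2 y) = 0 := h4 _ hx.2 _ hy.2
    rw [h6, add_zero] at h5
    exact h5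

lemma met_sq (a : Lˣ) : MetFam (Sum.elim (fun _ : Unit => a * a) (fun _ : Unit => - 1)) := by
  let f : L →ₗ[L] (Unit ⊕ Unit → L) :=
    { toFun := fun x => Sum.elim (fun _ => x) (fun _ => a * x)
      map_add' := by intro x y; ext (i | i) <;> simp [mul_add]
      map_smul' := by intro c x; ext (i | i) <;> simp; ring }
  refine ⟨LinearMap.range f, ?_, ?_⟩
  · rw [LinearMap.finrank_range_of_inj]
    · simp
    · intro x y h
      exact congrFun h (Sum.inl ())
  · rintro _ ⟨x, rfl⟩ _ ⟨y, rfl⟩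
    simp [f]; ring

lemma met_add (a b c : Lˣ) (h : (a : L) + b = c) :
    MetFam (Sum.elim ![a, b] (fun i => - (![c, c * (a * b)] : Fin 2 → Lˣ) i)) := by
  let f : (L × L) →ₗ[L] (Fin 2 ⊕ Fin 2 → L) :=
    { toFun := fun x => Sum.elim ![x.1 + b * x.2, x.1 - a * x.2] ![x.1, x.2]
      map_add' := by
        intro x y; ext (i | i) <;> fin_cases i <;> simp <;> ring
      map_smul' := by
        intro c x; ext (i | i) <;> fin_cases i <;> simp <;> ring }
  refine ⟨LinearMap.range f, ?_, ?_⟩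
  · rw [LinearMap.finrank_range_of_inj]
    · simp
    · intro x y h
      refine Prod.ext ?_ ?_
      · exact congrFun h (Sum.inr 0)
      · exact congrFun h (Sum.inr 1)
  · rintro _ ⟨x, rfl⟩ _ ⟨y, rfl⟩
    simp [f, Fin.sum_univ_two, ← h]; ring

end WittPart

open Module TensorProduct
section WittRing
variable {L : Type*} [Field L]

/-- formal sum -/
noncomputable def fsum {ι : Type*} [Fintype ι] (a : ι → Lˣ) : MonoidAlgebra ℤ Lˣ :=
  ∑ i, MonoidAlgebra.of ℤ Lˣ (a i)

def WP (f : MonoidAlgebra ℤ Lˣ) : Prop :=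
  ∃ (α β : Type) (_ : Fintype α) (_ : Fintype β) (a : α → Lˣ) (b : β → Lˣ),
    f = fsum a - fsum b ∧ MetFam (Sum.elim a (fun i => - b i))

lemma fsum_sum {ι κ : Type*} [Fintype ι] [Fintype κ] (a : ι → Lˣ) (b : κ → Lˣ) :
    fsum (Sum.elim a b) = fsum a + fsum b := by simp [fsum]

lemma WP_zero : WP (0 : MonoidAlgebra ℤ Lˣ) :=
  ⟨Empty, Empty, inferInstance, inferInstance, Empty.elim, Empty.elim, by simp [fsum],
    met_empty _⟩

lemma WP_add {f g : MonoidAlgebra ℤ Lˣ} (hf : WP f) (hg : WP g) : WP (f + g) := by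
  obtain ⟨α, β, _, _, a, b, rfl, h⟩ := hf
  obtain ⟨α', β', _, _, a', b', rfl, h'⟩ := hg
  refine ⟨α ⊕ α', β ⊕ β', inferInstance, inferInstance, Sum.elim a a', Sum.elim b b', ?_, ?_⟩
  · rw [fsum_sum, fsum_sum]; ring
  · refine met_equiv (Equiv.sumSumSumComm α β α' β') _ ?_
    convert met_sum _ _ h h' using 1
    ext ((i | i) | (i | i)) <;> rfl

lemma WP_neg {f : MonoidAlgebra ℤ Lˣ} (hf : WP f) : WP (-f) := by
  obtain ⟨α, β, _, _, a, b, rfl, h⟩ := hf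
  refine ⟨β, α, inferInstance, inferInstance, b, a, by ring, ?_⟩
  refine met_equiv (Equiv.sumComm α β) _ ?_
  convert met_smul (-1) _ h using 1
  ext (i | i) <;> simp

lemma WP_of {f : MonoidAlgebra ℤ Lˣ} (g : Lˣ) (hf : WP f) : WP (MonoidAlgebra.of ℤ Lˣ g * f) := by
  obtain ⟨α, β, _, _, a, b, rfl, h⟩ := hf
  refine ⟨α, β, inferInstance, inferInstance, fun i => g * a i, fun i => g * b i, ?_, ?_⟩
  · simp only [fsum, map_mul, mul_sub, Finset.mul_sum]
  · convert met_smul g _ h using 1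
    ext (i | i) <;> simp

lemma WP_mul {f : MonoidAlgebra ℤ Lˣ} (c : MonoidAlgebra ℤ Lˣ) (hf : WP f) : WP (c * f) := by
  induction c using MonoidAlgebra.induction_on with
  | of g => exact WP_of g hf
  | add x y hx hy => rw [add_mul]; exact WP_add hx hy
  | smul r x hx =>
    rw [smul_mul_assoc]
    induction r using Int.induction_on with
    | zero => simpa using WP_zero
    | succ n ih => rw [add_smul, one_smul]; exact WP_add ih hx
    | pred n ih => rw [sub_smul, one_smul, sub_eq_add_neg]; exact WP_add ih (WP_neg hx)

def WJ (L : Type*) [Field L] : Ideal (MonoidAlgebra ℤ Lˣ) where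
  carrier := {f | WP f}
  add_mem' := WP_add
  zero_mem' := WP_zero
  smul_mem' := fun c _ h => WP_mul c h

lemma fsum_inj {ι κ : Type} [Fintype ι] [Fintype κ] (a : ι → Lˣ) (b : κ → Lˣ)
    (h : fsum a = fsum b) : ∃ e : ι ≃ κ, ∀ i, b (e i) = a i := by
  classical
  have key : ∀ {ι : Type} [Fintype ι] (a : ι → Lˣ) (c : Lˣ),
      (fsum a).coeff c = (Fintype.card {i // a i = c} : ℤ) := by
    intro ι _ a c
    simp [fsum, MonoidAlgebra.of, Finsupp.single_apply, Fintype.card_subtype]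
    
  have h2 : ∀ c, Nonempty ({i // a i = c} ≃ {i // b i = c}) := fun c => by
    rw [← Fintype.card_eq]
    have h3 := key a c
    rw [h, key b c] at h3
    exact_mod_cast h3.symm
  exact ⟨Equiv.ofFiberEquiv (fun c => (h2 c).some), fun i => Equiv.ofFiberEquiv_map _ i⟩

lemma met_of_mem {ι : Type} [Fintype ι] (x : ι → Lˣ) (h : fsum x ∈ WJ L) : MetFam x := by
  obtain ⟨α, β, _, _, a, b, h1, h2⟩ := h
  obtain ⟨e, he⟩ := fsum_inj (Sum.elim x b) a (by rw [fsum_sum, h1]; ring)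
  refine met_cancel x (Sum.elim b (fun i => - b i)) ?_ (met_neg b)
  refine met_equiv (((Equiv.sumAssoc ι β β).symm.trans (e.sumCongr (Equiv.refl β))).symm) _ ?_
  convert h2 using 1
  ext (i | i)
  · obtain ⟨j, rfl⟩ := e.surjective i
    rw [Sum.elim_inl, he]
    rcases j with j | j <;> simp
  · simp

def WR (L : Type*) [Field L] := MonoidAlgebra ℤ Lˣ ⧸ WJ L

noncomputable instance instWR (L : Type*) [Field L] : CommRing (WR L) := Ideal.Quotient.commRing (WJ L)

noncomputable def WRmk (L : Type*) [Field L] : MonoidAlgebra ℤ Lˣ →+* WR L := Ideal.Quotient.mk (WJ L)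

lemma WRmk_zero {f : MonoidAlgebra ℤ Lˣ} : WRmk L f = 0 ↔ f ∈ WJ L := Ideal.Quotient.eq_zero_iff_mem

noncomputable def wchi (L : Type*) [Field L] : Lˣ →* WR L :=
  (WRmk L).toMonoidHom.comp (MonoidAlgebra.of ℤ Lˣ)

lemma wchi_met {ι : Type} [Fintype ι] (x : ι → Lˣ) (h : ∑ i, wchi L (x i) = 0) : MetFam x := by
  apply met_of_mem
  rw [← WRmk_zero, ← h, fsum, map_sum]; rfl

lemma wchi_rel {α β : Type} [Fintype α] [Fintype β] (a : α → Lˣ) (b : β → Lˣ)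
    (h : MetFam (Sum.elim a (fun i => - b i))) : ∑ i, wchi L (a i) = ∑ i, wchi L (b i) := by
  have : fsum a - fsum b ∈ WJ L := ⟨α, β, _, _, a, b, rfl, h⟩
  rw [← WRmk_zero, map_sub, sub_eq_zero, fsum, fsum, map_sum, map_sum] at this
  exact this

lemma wchi_neg_one : wchi L (-1) = -1 := by
  have := wchi_rel (L := L) (Sum.elim (fun _ : Unit => 1) (fun _ : Unit => -1)) (Empty.elim : Empty → Lˣ)
    (by
      refine met_equiv (Equiv.sumEmpty (Unit ⊕ Unit) Empty).symm _ ?_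
      convert met_neg (fun _ : Unit => (1 : Lˣ)) using 1
      ext (i | i) <;> rfl)
  simp at this
  exact (neg_eq_of_add_eq_zero_right this).symm

lemma wchi_sq (a : Lˣ) : wchi L a * wchi L a = 1 := by
  have := wchi_rel (L := L) (fun _ : Unit => a * a) (fun _ : Unit => 1) (met_sq a)
  simpa using this

lemma wchi_add (a b c : Lˣ) (h : (a : L) + b = c) :
    wchi L a + wchi L b = wchi L c * (1 + wchi L a * wchi L b) := by
  have := wchi_rel (L := L) _ _ (met_add a b c h)
  rw [mul_add, mul_one]
  simpa [Fin.sum_univ_two] using this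

end WittRing

open Module TensorProduct
section Pfister
variable {L : Type*} [Field L]

open Classical in
/-- sign -/
noncomputable def osgn (O : FieldOrdering L) (a : L) : ℤ :=
  if a ∈ O.carrier then 1 else if -a ∈ O.carrier then -1 else 0

lemma osgn_sq (O : FieldOrdering L) (a : L) (h : a ≠ 0) : osgn O a * osgn O a = 1 := by
  unfold osgn
  rcases O.total' a h with h | h
  · simp [h]
  · split_ifs <;> simp

lemma pfister_abs {A : Type*} [CommRing A] (χ : Lˣ →* A) (hneg : χ (-1) = -1)
    (hsq : ∀ a, χ a * χ a = 1)
    (hadd : ∀ a b c : Lˣ, (a : L) + b = c → χ a + χ b = χ c * (1 + χ a * χ b))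
    {ι : Type*} [Fintype ι] (w : ι → Lˣ)
    (h : ∀ O : FieldOrdering L, ∑ i, osgn O (w i) = 0) :
    ∃ n : ℕ, (2 : A) ^ n * ∑ i, χ (w i) = 0 := by
  set x := ∑ i, χ (w i) with hx
  let I : Ideal A :=
    { carrier := {y | ∃ n : ℕ, (2 : A) ^ n * (y * x) = 0}
      zero_mem' := ⟨0, by simp⟩
      add_mem' := by
        rintro a b ⟨n, hn⟩ ⟨m, hm⟩
        refine ⟨n + m, ?_⟩
        calc (2 : A) ^ (n + m) * ((a + b) * x) = 2 ^ m * (2 ^ n * (a * x)) + 2 ^ n * (2 ^ m * (b * x)) := by ring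
          _ = 0 := by rw [hn, hm]; ring
      smul_mem' := by
        rintro c a ⟨n, hn⟩
        refine ⟨n, ?_⟩
        calc (2 : A) ^ n * (c • a * x) = c * (2 ^ n * (a * x)) := by rw [smul_eq_mul]; ring
          _ = 0 := by rw [hn]; ring }
  by_contra hcon
  push Not at hcon
  have hdis : Disjoint (I : Set A) (Submonoid.powers (2 : A) : Set A) := by
    rw [Set.disjoint_left]
    rintro _ ⟨n, hn⟩ ⟨m, rfl⟩
    apply hcon (n + m)
    rw [← hn]; ring
  obtain ⟨p, hp, hIp, hp2⟩ := Ideal.exists_le_prime_disjoint I (Submonoid.powers (2 : A)) hdis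
  have h2 : (2 : A) ∉ p := fun h => Set.disjoint_left.1 hp2 h ⟨1, by simp⟩
  have hnegu : ∀ u, χ (-u) = - χ u := fun u => by
    rw [← neg_one_mul, map_mul, hneg, neg_one_mul]
  have hor : ∀ u, χ u - 1 ∈ p ∨ χ u + 1 ∈ p := fun u => by
    apply hp.mem_or_mem
    have : (χ u - 1) * (χ u + 1) = 0 := by linear_combination hsq u
    rw [this]; exact p.zero_mem
  have hnot : ∀ u, χ u - 1 ∈ p → χ u + 1 ∈ p → False := fun u h1 h3 => by
    apply h2
    have := p.sub_mem h3 h1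
    convert this using 1; ring
  let O : FieldOrdering L :=
    { carrier := {a | ∃ u : Lˣ, (u : L) = a ∧ χ u - 1 ∈ p}
      add_mem' := by
        rintro _ _ ⟨a, rfl, ha⟩ ⟨b, rfl, hb⟩
        have h0 : (a : L) + b ≠ 0 := by
          intro h0
          have : b = -a := by ext; push_cast; linear_combination h0
          rw [this, hnegu] at hb
          refine hnot a ha ?_
          convert p.neg_mem hb using 1; ring
        refine ⟨Units.mk0 _ h0, rfl, ?_⟩
        have h3 := hadd a b (Units.mk0 _ h0) rfl
        set c := Units.mk0 _ h0
        have h4 : 2 * (χ c - 1) ∈ p := by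
          have : 2 * (χ c - 1) = (χ a - 1) + (χ b - 1) - χ c * ((χ a - 1) * χ b + (χ b - 1)) := by
            linear_combination -h3
          rw [this]
          exact p.sub_mem (p.add_mem ha hb) (p.mul_mem_left _ (p.add_mem (p.mul_mem_right _ ha) hb))
        exact (hp.mem_or_mem h4).resolve_left h2
      mul_mem' := by
        rintro _ _ ⟨a, rfl, ha⟩ ⟨b, rfl, hb⟩
        refine ⟨a * b, by simp, ?_⟩
        rw [map_mul]
        have : χ a * χ b - 1 = (χ a - 1) * χ b + (χ b - 1) := by ring
        rw [this]
        exact p.add_mem (p.mul_mem_right _ ha) hb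
      total' := by
        intro a ha
        rcases hor (Units.mk0 a ha) with h | h
        · exact Or.inl ⟨_, rfl, h⟩
        · refine Or.inr ⟨-Units.mk0 a ha, by simp, ?_⟩
          rw [hnegu]
          convert p.neg_mem h using 1; ring
      disjoint' := by
        rintro _ ⟨a, rfl, ha⟩ ⟨b, hb, hb'⟩
        have : b = -a := by ext; rw [hb]; simp
        rw [this, hnegu] at hb'
        refine hnot a ha ?_
        convert p.neg_mem hb' using 1; ring }
  have hsg : ∀ u : Lˣ, χ u - (osgn O u : A) ∈ p := by
    intro u
    unfold osgn
    by_cases hu : (u : L) ∈ O.carrier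
    · rw [if_pos hu]
      obtain ⟨v, hv, hv'⟩ := hu
      rw [Units.ext hv] at hv'
      simpa using hv'
    · have h4 := (O.total' u u.ne_zero).resolve_left hu
      rw [if_neg hu, if_pos h4]
      obtain ⟨v, hv, hv'⟩ := h4
      have : v = -u := by ext; rw [hv]; simp
      rw [this, hnegu] at hv'
      convert p.neg_mem hv' using 1; push_cast; ring
  have hO := h O
  let y : A := ∏ i, (1 + (osgn O (w i) : A) * χ (w i))
  have hsq2 : ∀ u : Lˣ, (osgn O u : A) * osgn O u = 1 := fun u => by
    have := osgn_sq O u u.ne_zero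
    exact_mod_cast congrArg (Int.cast : ℤ → A) this
  have hy : ∀ i, y * χ (w i) = (osgn O (w i) : A) * y := by
    classical
    intro i
    simp only [y]
    rw [← Finset.mul_prod_erase _ _ (Finset.mem_univ i)]
    linear_combination (∏ x ∈ Finset.univ.erase i, (1 + (osgn O (w x) : A) * χ (w x))) * ((osgn O (w i) : A) * hsq (w i) - χ (w i) * hsq2 (w i))
  have hyx : y * x = 0 := by
    rw [hx, Finset.mul_sum, Finset.sum_congr rfl fun i _ => hy i, ← Finset.sum_mul, ← Int.cast_sum, hO]
    simp
  have hyp : y ∈ p := hIp ⟨0, by rw [hyx]; simp⟩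
  obtain ⟨i, -, hi⟩ := (hp.prod_mem_iff).1 hyp
  apply h2
  have h5 : (2 : A) = (1 + (osgn O (w i) : A) * χ (w i)) - (osgn O (w i) : A) * (χ (w i) - osgn O (w i)) := by
    linear_combination - hsq2 (w i)
  rw [h5]
  exact p.sub_mem hi (p.mul_mem_left _ (hsg _))

lemma pfister {ι : Type} [Fintype ι] (w : ι → Lˣ)
    (h : ∀ O : FieldOrdering L, ∑ i, osgn O (w i) = 0) :
    ∃ n : ℕ, ∀ m, n ≤ m → MetFam (fun z : Fin (2 ^ m) × ι => w z.2) := by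
  obtain ⟨n, hn⟩ := pfister_abs (wchi L) wchi_neg_one wchi_sq wchi_add w h
  refine ⟨n, fun m hm => wchi_met _ ?_⟩
  rw [Fintype.sum_prod_type]
  obtain ⟨k, rfl⟩ := Nat.exists_eq_add_of_le hm
  simp only [Finset.sum_const, Finset.card_univ, Fintype.card_fin, nsmul_eq_mul]
  push_cast
  rw [pow_add, mul_comm (2 ^ n), mul_assoc, hn, mul_zero]

/-- metabolic families give a skew involution -/
lemma met_skew {ι : Type*} [Fintype ι] [DecidableEq ι] (a : ι → Lˣ) (h : MetFam a) :
    ∃ S : Matrix ι ι L, S * S = 1 ∧ ∀ i j, (a i : L) * S i j = - ((a j : L) * S j i) := by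
  obtain ⟨Λ, h1, h2⟩ := h
  have hort : (diagB a).orthogonal Λ = Λ := by
    symm
    apply Submodule.eq_of_le_of_finrank_le
    · intro x hx n hn; exact h2 n hn x hx
    · rw [LinearMap.BilinForm.finrank_orthogonal (diagB_nondeg a)]
      simp; omega
  obtain ⟨M, hM⟩ := Submodule.exists_isCompl Λ
  let e := Submodule.projection Λ M hM
  have heΛ : ∀ x, e x ∈ Λ := fun x => Submodule.projection_apply_mem hM x
  have heid : ∀ x ∈ Λ, e x = x := fun x hx => Submodule.projection_apply_left hM ⟨x, hx⟩
  let E := LinearMap.toMatrix' e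
  let A : Matrix ι ι L := Matrix.diagonal fun i => (a i : L)
  let A' : Matrix ι ι L := Matrix.diagonal fun i => ((a i)⁻¹ : Lˣ)
  have hAA : A * A' = 1 := by simp [A, A', Matrix.diagonal_mul_diagonal]
  have hAA' : A' * A = 1 := by simp [A, A', Matrix.diagonal_mul_diagonal]
  have hAt : A.transpose = A := Matrix.diagonal_transpose _
  have hA't : A'.transpose = A' := Matrix.diagonal_transpose _
  let F : Matrix ι ι L := A' * E.transpose * A
  have hd : ∀ x y, diagB a x y = x ⬝ᵥ (A.mulVec y) := by
    intro x y
    simp [diagB_apply, A, Matrix.mulVec_diagonal, dotProduct]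
    refine Finset.sum_congr rfl fun i _ => by ring
  have hE : ∀ x, E.mulVec x = e x := fun x => by simp [E]
  have hEE : E * E = E := by
    rw [← LinearMap.toMatrix'_mul]
    congr 1
    ext1 x
    ext1
    simp [heid _ (heΛ _)]
  have hFF : F * F = F := by
    have : E.transpose * E.transpose = E.transpose := by rw [← Matrix.transpose_mul, hEE]
    calc F * F = A' * E.transpose * (A * A') * E.transpose * A := by simp only [F, Matrix.mul_assoc]
      _ = A' * (E.transpose * E.transpose) * A := by rw [hAA]; simp only [Matrix.mul_assoc, Matrix.one_mul, Matrix.mul_one]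
      _ = F := by rw [this]
  have hext : ∀ B C : Matrix ι ι L, (∀ x y, x ⬝ᵥ (B.mulVec y) = x ⬝ᵥ (C.mulVec y)) → B = C := by
    intro B C h
    ext i j
    have := h (Pi.single i 1) (Pi.single j 1)
    simpa using this
  have hadj : ∀ x y, diagB a x (F.mulVec y) = diagB a (e x) y := by
    intro x y
    rw [hd, hd, ← hE, Matrix.mulVec_mulVec]
    have : A * F = E.transpose * A := by
      simp only [F]; rw [← Matrix.mul_assoc, ← Matrix.mul_assoc, hAA, Matrix.one_mul]
    rw [this, ← Matrix.mulVec_mulVec, Matrix.dotProduct_mulVec x, Matrix.vecMul_transpose]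
  have hFE : F * E = 0 := by
    apply Matrix.ext_of_mulVec_single
    intro i
    rw [← Matrix.mulVec_mulVec, Matrix.zero_mulVec]
    apply diagB_sep a
    intro y
    rw [diagB_symm, hadj, hE]
    exact h2 _ (heΛ _) _ (heΛ _)
  have hEF : (1 - E) * (1 - F) = 0 := by
    apply Matrix.ext_of_mulVec_single
    intro i
    rw [← Matrix.mulVec_mulVec, Matrix.zero_mulVec, Matrix.sub_mulVec 1 E, Matrix.one_mulVec, hE, heid, sub_self]
    rw [← hort]
    intro x hx
    change diagB a x _ = 0
    rw [Matrix.sub_mulVec, map_sub, hadj, heid x hx, Matrix.one_mulVec, sub_self]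
  refine ⟨E - F, ?_, ?_⟩
  · have h6 : E * F = E + F - 1 := by
      have : (1 - E) * (1 - F) = 1 - E - F + E * F := by noncomm_ring
      rw [this] at hEF
      rw [← sub_eq_zero, ← hEF]; abel
    have : (E - F) * (E - F) = E * E - E * F - F * E + F * F := by noncomm_ring
    rw [this, hEE, hFF, hFE, h6]; abel
  · intro i j
    simp only [F, A, A', Matrix.sub_apply, Matrix.diagonal_mul, Matrix.mul_diagonal, Matrix.transpose_apply]
    have := (a i).ne_zero
    have := (a j).ne_zero
    push_cast
    field_simp
    ring
end Pfister

open Module TensorProduct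
section SigPart

namespace FieldOrdering
variable {K : Type*} [Field K] (O : FieldOrdering K)

lemma zero_nmem : (0 : K) ∉ O.carrier := fun h => by
  have := O.disjoint' 0 h
  rw [neg_zero] at this
  exact this h

open Classical in
/-- the linear order -/
noncomputable abbrev lo : LinearOrder K where
  le a b := a = b ∨ b - a ∈ O.carrier
  lt a b := b - a ∈ O.carrier
  le_refl a := Or.inl rfl
  le_trans a b c := by
    rintro (rfl | h1) (rfl | h2)
    · exact Or.inl rfl
    · exact Or.inr h2
    · exact Or.inr h1
    · right
      have := O.add_mem' h1 h2
      convert this using 1; ring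
  le_antisymm a b := by
    rintro (rfl | h1) (h | h2)
    · rfl
    · rfl
    · exact h.symm
    · exfalso
      apply O.disjoint' _ h1
      convert h2 using 1; ring
  lt_iff_le_not_ge a b := by
    constructor
    · intro h
      refine ⟨Or.inr h, ?_⟩
      rintro (rfl | h2)
      · rw [sub_self] at h; exact O.zero_nmem h
      · apply O.disjoint' _ h
        convert h2 using 1; ring
    · rintro ⟨rfl | h1, h2⟩
      · exact absurd (Or.inl rfl) h2
      · exact h1
  le_total a b := by
    by_cases h : a = b
    · exact Or.inl (Or.inl h)
    · rcases O.total' (b - a) (sub_ne_zero.2 (Ne.symm h)) with h | h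
      · exact Or.inl (Or.inr h)
      · refine Or.inr (Or.inr ?_)
        convert h using 1; ring
  toDecidableLE := Classical.decRel _

lemma so : letI := O.lo; IsStrictOrderedRing K := by
  letI := O.lo
  have h1 : (1 : K) ∈ O.carrier := by
    rcases O.total' 1 one_ne_zero with h | h
    · exact h
    · have := O.mul_mem' h h
      simpa using this
  haveI : IsOrderedAddMonoid K := 
    { add_le_add_left := by
        rintro a b (rfl | h) c
        · exact Or.inl rfl
        · right
          convert h using 1; ring }
  haveI : ZeroLEOneClass K := ⟨by right; simpa using h1⟩
  exact IsStrictOrderedRing.of_mul_pos (by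
    intro a b ha hb
    change a * b - 0 ∈ O.carrier
    have ha' : a - 0 ∈ O.carrier := ha
    have hb' : b - 0 ∈ O.carrier := hb
    rw [sub_zero] at *
    exact O.mul_mem' ha' hb')

lemma pos_iff (a : K) : letI := O.lo; 0 < a ↔ a ∈ O.carrier := by
  letI := O.lo
  change a - 0 ∈ O.carrier ↔ _
  rw [sub_zero]

end FieldOrdering

variable {K : Type*} [Field K] [LinearOrder K]
variable {V V' M : Type*} [AddCommGroup V] [Module K V] [AddCommGroup V'] [Module K V']
  [AddCommGroup M] [Module K M]

noncomputable def sg (Q : QuadraticForm K V) : ℤ := (sigPos Q : ℤ) - sigNeg Q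

def sgw (a : K) : ℤ := if 0 < a then 1 else if a < 0 then -1 else 0

lemma signatureAt_eq {K : Type*} [Field K] {V : Type*} [AddCommGroup V] [Module K V]
    [FiniteDimensional K V] (O : FieldOrdering K) (Q : QuadraticForm K V) :
    signatureAt O (fun v => Q v) = letI := O.lo; sg Q := by
  letI := O.lo
  have := O.so
  unfold signatureAt sg
  congr 2
  · apply IsGreatest.csSup_eq
    convert sigPos_isGreatest Q using 5 with n U
    · rfl
    refine and_congr_right fun _ => ?_
    constructor
    · rintro h ⟨v, hv⟩ h0
      simp only [QuadraticMap.restrict_apply]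
      rw [O.pos_iff]
      exact h v hv (fun h => h0 (Subtype.ext h))
    · intro h v hv h0
      have := h ⟨v, hv⟩ (fun h => h0 (congrArg Subtype.val h))
      rwa [QuadraticMap.restrict_apply, O.pos_iff] at this
  · apply IsGreatest.csSup_eq
    convert sigNeg_isGreatest Q using 5 with n U
    · rfl
    refine and_congr_right fun _ => ?_
    constructor
    · rintro h ⟨v, hv⟩ h0
      simp only [QuadraticMap.restrict_apply]
      rw [O.pos_iff]
      exact h v hv (fun h => h0 (Subtype.ext h))
    · intro h v hv h0
      have := h ⟨v, hv⟩ (fun h => h0 (congrArg Subtype.val h))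
      rwa [QuadraticMap.restrict_apply, O.pos_iff] at this

lemma osgn_eq {K : Type*} [Field K] (O : FieldOrdering K) (a : K) :
    osgn O a = letI := O.lo; sgw a := by
  letI := O.lo
  have h1 : (a < 0) ↔ -a ∈ O.carrier := by
    change 0 - a ∈ O.carrier ↔ _
    rw [zero_sub]
  unfold osgn sgw
  rw [← O.pos_iff a, ← h1]
  congr

lemma sg_equiv (Q : QuadraticForm K V) (Q' : QuadraticForm K V') (e : V ≃ₗ[K] V')
    (h : ∀ x, Q' (e x) = Q x) : sg Q = sg Q' := by
  have : QuadraticMap.Equivalent Q Q' := ⟨⟨e, h⟩⟩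
  rw [sg, sg, this.sigPos_eq, this.sigNeg_eq]

variable [IsStrictOrderedRing K]

lemma sg_wss {ι : Type*} [Fintype ι] (w : ι → K) :
    sg (QuadraticMap.weightedSumSquares K w) = ∑ i, sgw (w i) := by
  classical
  rw [sg, QuadraticForm.sigPos_weightedSumSquares, QuadraticForm.sigNeg_weightedSumSquares]
  have e : ∀ i, sgw (w i) = (if 0 < w i then 1 else 0) - (if w i < 0 then 1 else 0) := by
    intro i
    unfold sgw
    split_ifs with h1 h2 <;> first | rfl | (exfalso; exact lt_asymm h1 h2)
  rw [Finset.sum_congr rfl fun i _ => e i, Finset.sum_sub_distrib]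
  rw [Set.ncard_eq_toFinset_card', Set.ncard_eq_toFinset_card']
  simp

lemma sg_pi {ι : Type*} [Fintype ι] {E : ι → Type*} [∀ i, AddCommGroup (E i)]
    [∀ i, Module K (E i)] [∀ i, FiniteDimensional K (E i)]
    (Q : QuadraticForm K (∀ i, E i)) (q : ∀ i, QuadraticForm K (E i))
    (h : ∀ x, Q x = ∑ i, q i (x i)) : sg Q = ∑ i, sg (q i) := by
  have : Invertible (2 : K) := invertibleOfNonzero two_ne_zero
  choose w hw using fun i => (q i).equivalent_weightedSumSquares
  have e := fun i => (hw i).some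
  have h1 : ∀ i, sg (q i) = ∑ j, sgw (w i j) := fun i => by
    rw [← sg_wss]
    exact sg_equiv _ _ (e i).toLinearEquiv (e i).map_app'
  simp only [h1]
  rw [← Fintype.sum_sigma' (fun i j => sgw (w i j)), ← sg_wss]
  refine sg_equiv _ _ ((LinearEquiv.piCongrRight fun i => (e i).toLinearEquiv).trans
    (LinearEquiv.piCurry K (fun i (_ : Fin (finrank K (E i))) => K)).symm) ?_
  intro x
  rw [h, QuadraticMap.weightedSumSquares_apply, Fintype.sum_sigma]
  refine Finset.sum_congr rfl fun i _ => ?_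
  rw [← (e i).map_app (x i), QuadraticMap.weightedSumSquares_apply]
  rfl

lemma red_half [FiniteDimensional K V] [FiniteDimensional K M]
    (Q : QuadraticForm K V) (ψ : QuadraticForm K M)
    (h : V' →ₗ[K] V) (ρ : V' →ₗ[K] M) (hh : ∀ x, Q (h x) = ψ (ρ x)) :
    sigPos Q + finrank K (LinearMap.range h) ≤ sigPos ψ + finrank K V := by
  obtain ⟨U, hU, hpos⟩ := exists_finrank_eq_sigPos_and_posDef Q
  obtain ⟨g, hg⟩ := LinearMap.exists_rightInverse_of_surjective h.rangeRestrict h.range_rangeRestrict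
  have hg' : ∀ x : LinearMap.range h, h (g x) = x := fun x => by
    have := LinearMap.congr_fun hg x
    exact congrArg Subtype.val this
  let U' := U.comap (LinearMap.range h).subtype
  have key : ∀ x ∈ U', x ≠ 0 → 0 < ψ (ρ (g x)) := by
    intro x hx h0
    rw [← hh, hg']
    exact hpos ⟨x, hx⟩ (fun h => h0 (Subtype.ext (show (x : V) = 0 from congrArg (Subtype.val : U → V) h)))
  have h1 : finrank K (U'.map (ρ ∘ₗ g)) ≤ sigPos ψ := by
    apply le_sigPos_of_posDef
    rintro ⟨_, x, hx, rfl⟩ h0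
    exact key x hx (by rintro rfl; exact h0 (Subtype.ext (by simp)))
  have h2 : finrank K (U'.map (ρ ∘ₗ g)) = finrank K U' := by
    rw [← LinearMap.range_domRestrict, LinearMap.finrank_range_of_inj]
    rw [← LinearMap.ker_eq_bot, LinearMap.ker_eq_bot']
    rintro ⟨x, hx⟩ hx0
    by_contra hne
    have := key x hx (fun h => hne (Subtype.ext h))
    change ρ (g x) = 0 at hx0
    rw [hx0] at this
    simp at this
  have h3 : finrank K U' = finrank K (U ⊓ LinearMap.range h : Submodule K V) := by
    rw [← Submodule.finrank_map_subtype_eq, Submodule.map_comap_subtype, inf_comm]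
  have h4 := Submodule.finrank_sup_add_finrank_inf_eq U (LinearMap.range h)
  have h5 := Submodule.finrank_le (U ⊔ LinearMap.range h)
  omega

lemma sg_red [FiniteDimensional K V] [FiniteDimensional K M]
    (Q : QuadraticForm K V) (ψ : QuadraticForm K M)
    (h : V' →ₗ[K] V) (ρ : V' →ₗ[K] M) (hh : ∀ x, Q (h x) = ψ (ρ x))
    (hd : finrank K M + finrank K V + finrank K Q.radical ≤ 2 * finrank K (LinearMap.range h)) :
    sg Q = sg ψ := by
  have h1 := red_half Q ψ h ρ hh
  have h2 := red_half (-Q) (-ψ) h ρ (by simpa using hh)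
  have h3 := QuadraticForm.sigPos_add_sigNeg_add_radical (Q := Q)
  have h4 := QuadraticForm.sigPos_add_sigNeg_add_radical (Q := ψ)
  rw [sigPos_neg, sigPos_neg] at h2
  unfold sg
  omega

lemma sg_sub [Subsingleton V] (Q : QuadraticForm K V) : sg Q = 0 := by
  have h3 := QuadraticForm.sigPos_add_sigNeg_add_radical (Q := Q)
  have := Module.finrank_zero_of_subsingleton (R := K) (M := V)
  unfold sg
  omega

lemma mem_rad (B : LinearMap.BilinForm K V) (hB : B.IsSymm) (x : V) :
    x ∈ B.toQuadraticMap.radical ↔ ∀ y, B x y = 0 := by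
  have : Invertible (2 : K) := invertibleOfNonzero two_ne_zero
  rw [QuadraticMap.radical_eq_ker_polarBilin, LinearMap.mem_ker, LinearMap.ext_iff]
  refine forall_congr' fun y => ?_
  simp only [QuadraticMap.polarBilin_apply_apply, LinearMap.zero_apply, LinearMap.BilinMap.polar_toQuadraticMap]
  rw [show B y x = B x y from (hB.eq x y).symm, ← two_mul]
  simp
end SigPart

open Module TensorProduct
section RC
variable {K : Type*} [Field K]

lemma rc_odd (hK : IsRealClosedField K) [CharZero K] {E : Type*} [Field E] [Algebra K E] [FiniteDimensional K E]
    (h : Odd (finrank K E)) : finrank K E = 1 := by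
  obtain ⟨α, hα⟩ := Field.exists_primitive_element K E
  have h1 : (minpoly K α).natDegree = finrank K E := by
    rw [← IntermediateField.adjoin.finrank (Algebra.IsIntegral.isIntegral α), hα, IntermediateField.finrank_top']
  obtain ⟨x, hx⟩ := hK.2.2.2 (minpoly K α) (by rw [h1]; exact h)
  rw [← h1]
  exact Polynomial.natDegree_eq_of_degree_eq_some (Polynomial.degree_eq_one_of_irreducible_of_root (minpoly.irreducible (Algebra.IsIntegral.isIntegral α)) hx)

lemma rc_quad (hK : IsRealClosedField K) [CharZero K] {E : Type*} [Field E] [Algebra K E] [FiniteDimensional K E]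
    (h : finrank K E = 2) : IsSquare (-1 : E) := by
  obtain ⟨α, hα⟩ := Field.exists_primitive_element K E
  have hint := Algebra.IsIntegral.isIntegral (R := K) α
  have h1 : (minpoly K α).natDegree = 2 := by
    rw [← IntermediateField.adjoin.finrank hint, hα, IntermediateField.finrank_top', h]
  have hm := minpoly.monic hint
  have h0 := minpoly.aeval K α
  set P := minpoly K α with hP
  have hP2 : P.coeff 2 = 1 := by rw [← h1]; exact hm
  rw [Polynomial.aeval_eq_sum_range, h1] at h0
  simp only [Finset.sum_range_succ, Finset.sum_range_zero, Algebra.smul_def, hP2] at h0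
  set b := P.coeff 1
  set c := P.coeff 0
  set β : E := 2 * α + algebraMap K E b
  have hβ : β * β = algebraMap K E (b * b - 4 * c) := by
    simp only [β, map_sub, map_mul, map_ofNat]
    simp only [map_one] at h0
    linear_combination 4 * h0
  have hnK : ∀ k : K, β ≠ algebraMap K E k := by
    intro k hk
    have : α = algebraMap K E ((k - b) / 2) := by
      simp only [map_div₀, map_sub, map_ofNat, ← hk, β]
      have : (2 : E) ≠ 0 := by
        have := (algebraMap K E).injective.ne (two_ne_zero : (2 : K) ≠ 0)
        rwa [map_ofNat, map_zero] at this
      field_simp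
      ring
    have h3 : (minpoly K α).natDegree = 1 := by
      rw [this, minpoly.eq_X_sub_C]; simp
    rw [← hP, h1] at h3
    omega
  rcases hK.2.1 (b * b - 4 * c) with ⟨e, he⟩ | ⟨e, he⟩
  · exfalso
    rw [he, map_mul, mul_self_eq_mul_self_iff] at hβ
    rcases hβ with h | h
    · exact hnK _ h
    · rw [← map_neg] at h; exact hnK _ h
  · have he0 : e ≠ 0 := by
      rintro rfl
      rw [mul_zero, neg_eq_zero] at he
      rw [he, map_zero, mul_self_eq_zero] at hβ
      exact hnK 0 (by rw [hβ, map_zero])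
    have he1 : algebraMap K E e ≠ 0 := by simpa using he0
    refine ⟨β / algebraMap K E e, ?_⟩
    have : b * b - 4 * c = - (e * e) := by rw [← he, neg_neg]
    rw [this, map_neg, map_mul] at hβ
    field_simp
    linear_combination -hβ

lemma rc_surj (hK : IsRealClosedField K) [CharZero K] {L : Type*} [Field L] [Algebra K L]
    [FiniteDimensional K L] (hL : ¬ IsSquare (-1 : L)) : Function.Surjective (algebraMap K L) := by
  let Ω := AlgebraicClosure L
  let M := IntermediateField.normalClosure K L Ω
  haveI : Normal K M := normalClosure.normal K L Ω
  haveI : FiniteDimensional K M := normalClosure.is_finiteDimensional K L Ω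
  haveI : IsGalois K M := { }
  let f : L →ₐ[K] M := IsScalarTower.toAlgHom K L M
  let F0 := f.fieldRange
  let G := Gal(M/K)
  haveI : Fact (Nat.Prime 2) := ⟨Nat.prime_two⟩
  -- step 1
  have hcard : ∀ H : Subgroup G, finrank K (IntermediateField.fixedField H) * Nat.card H = Nat.card G := by
    intro H
    have h1 : finrank (IntermediateField.fixedField H) M = Nat.card H := IntermediateField.finrank_fixedField_eq_card H
    have h2 := Module.finrank_mul_finrank K (IntermediateField.fixedField H) M
    rw [← h1, h2, IsGalois.card_aut_eq_finrank]
  obtain ⟨n, hn⟩ : ∃ n, Nat.card G = 2 ^ n := by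
    let S : Sylow 2 G := default
    have h1 := hcard (S : Subgroup G)
    have h2 : Odd (finrank K (IntermediateField.fixedField (S : Subgroup G))) := by
      have h3 := S.not_dvd_index
      have h4 := Subgroup.index_mul_card (S : Subgroup G)
      have h5 : finrank K (IntermediateField.fixedField (S : Subgroup G)) = (S : Subgroup G).index := by
        rw [← h1] at h4
        exact (Nat.eq_of_mul_eq_mul_right Nat.card_pos h4).symm
      rw [h5, ← Nat.not_even_iff_odd, even_iff_two_dvd]; exact h3
    rw [rc_odd hK h2, one_mul, Sylow.card_eq_multiplicity] at h1
    exact ⟨_, h1.symm⟩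
  by_cases hF : F0 = ⊥
  · intro x
    have h1 : f x ∈ F0 := ⟨x, rfl⟩
    rw [hF, IntermediateField.mem_bot] at h1
    obtain ⟨k, hk⟩ := h1
    refine ⟨k, f.toRingHom.injective ?_⟩
    change f _ = f x
    rw [← hk]; exact f.commutes k
  exfalso
  let H := F0.fixingSubgroup
  have hfix : IntermediateField.fixedField H = F0 := IsGalois.fixedField_fixingSubgroup F0
  have hHt : H ≠ ⊤ := by
    intro h
    apply hF
    rw [← hfix, h]
    exact ((IsGalois.tfae (F := K) (E := M)).out 0 1).1 ‹IsGalois K M›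
  obtain ⟨m, hm, hm2⟩ := (Nat.dvd_prime_pow Nat.prime_two).1 (hn ▸ Subgroup.card_subgroup_dvd_card H)
  have hmn : m < n := by
    rcases hm.lt_or_eq with h | h
    · exact h
    · exfalso; apply hHt
      apply Subgroup.eq_top_of_card_eq
      rw [hm2, hn, h]
  obtain ⟨k, rfl⟩ : ∃ k, n = k + 1 := ⟨n - 1, by omega⟩
  obtain ⟨H', hH', hle⟩ := Sylow.exists_subgroup_card_pow_prime_le (n := m) (m := k) 2
    (by rw [hn]; exact pow_dvd_pow _ (by omega)) H hm2 (by omega)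
  have h2 : finrank K (IntermediateField.fixedField H') = 2 := by
    have := hcard H'
    rw [hH', hn, pow_succ', ] at this
    exact Nat.eq_of_mul_eq_mul_right (by positivity) this
  obtain ⟨y, hy⟩ := rc_quad hK h2
  have hle2 : IntermediateField.fixedField H' ≤ F0 := by
    rw [← hfix]; exact IntermediateField.fixedField_antitone hle
  obtain ⟨z, hz⟩ := hle2 y.2
  apply hL
  refine ⟨z, f.toRingHom.injective ?_⟩
  have hy' := congrArg Subtype.val hy
  change f (-1) = f (z * z)
  have hz' : f z = (y : M) := hz
  rw [map_mul, hz', map_neg, map_one]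
  exact hy'
end RC

open Module TensorProduct
section Herm
variable {K : Type*} [Field K] {L : Type*} [Field L] [Algebra K L]

/-- scaled trace form -/
noncomputable def trB (K : Type*) [Field K] {L : Type*} [Field L] [Algebra K L] (w : L) :
    LinearMap.BilinForm K L :=
  (Algebra.traceForm K L).compLeft (LinearMap.mulLeft K w)

lemma trB_apply (w x y : L) : trB K w x y = Algebra.trace K L (w * x * y) := rfl

lemma trB_symm (w : L) : (trB K w).IsSymm := ⟨fun x y => by
  simp only [trB_apply, RingHom.id_apply]; congr 1; ring⟩

/-- restriction of orderings -/
def FieldOrdering.comap (K : Type*) [Field K] {L : Type*} [Field L] [Algebra K L]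
    (O : FieldOrdering L) : FieldOrdering K where
  carrier := {a | algebraMap K L a ∈ O.carrier}
  add_mem' a b ha hb := by
    simp only [Set.mem_setOf_eq, map_add]; exact O.add_mem' ha hb
  mul_mem' a b ha hb := by
    simp only [Set.mem_setOf_eq, map_mul]; exact O.mul_mem' ha hb
  total' a ha := by
    simp only [Set.mem_setOf_eq, map_neg]; exact O.total' _ (by simpa using ha)
  disjoint' a ha := by
    simp only [Set.mem_setOf_eq, map_neg]; exact O.disjoint' _ ha

lemma ord_no_sq (O : FieldOrdering L) : ¬ IsSquare (-1 : L) := by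
  rintro ⟨i, hi⟩
  letI := O.lo
  have := O.so
  have h := mul_self_nonneg i
  rw [← hi] at h
  linarith [zero_lt_one (α := L)]

lemma ord_charZero (O : FieldOrdering L) : CharZero L := by
  letI := O.lo
  have := O.so
  infer_instance

lemma sep_rc (hK : IsRealClosedField K) [FiniteDimensional K L] {ι : Type*} [Fintype ι] (w : ι → L)
    (h : ∀ O : FieldOrdering K, ∀ g : L, g ≠ 0 → ∑ i, signatureAt O (fun x => trB K (g * w i) x x) = 0)
    (O : FieldOrdering L) : ∑ i, osgn O (w i) = 0 := by
  have h1 := h (O.comap K) 1 one_ne_zero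
  rw [← h1]
  refine Finset.sum_congr rfl fun i _ => ?_
  have hcz := ord_charZero (O.comap K)
  have hs := rc_surj hK (ord_no_sq O)
  obtain ⟨k, hk⟩ := hs (w i)
  have h2 := signatureAt_eq (O.comap K) (trB K (1 * w i)).toQuadraticMap
  simp only [LinearMap.BilinMap.toQuadraticMap_apply] at h2
  rw [h2]
  have h3 : osgn O (w i) = osgn (O.comap K) k := by
    rw [← hk]
    unfold osgn
    have e1 : (-k ∈ (O.comap K).carrier) ↔ -(algebraMap K L k) ∈ O.carrier := by
      rw [← map_neg]; rfl
    have e2 : (k ∈ (O.comap K).carrier) ↔ (algebraMap K L k) ∈ O.carrier := Iff.rfl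
    classical
    exact if_congr e2.symm rfl (if_congr e1.symm rfl rfl)
  rw [h3, osgn_eq]
  letI := (O.comap K).lo
  have := (O.comap K).so
  have h4 : sgw k = ∑ _i : Unit, sgw k := by simp
  let e : K ≃ₗ[K] L := LinearEquiv.ofBijective (Algebra.linearMap K L) ⟨(algebraMap K L).injective, hs⟩
  have hfr : finrank K L = 1 := by rw [← e.finrank_eq, finrank_self]
  change sgw k = sg _
  rw [h4, ← sg_wss (fun _ : Unit => k)]
  refine sg_equiv _ _ ((LinearEquiv.funUnique Unit K K).trans e) ?_
  intro x
  have he : ∀ y : K, e y = algebraMap K L y := fun y => rfl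
  simp only [LinearEquiv.trans_apply, LinearMap.BilinMap.toQuadraticMap_apply, trB_apply, he, ← hk, one_mul,
    ← map_mul, Algebra.trace_algebraMap, hfr, one_smul, QuadraticMap.weightedSumSquares_apply]
  simp [mul_assoc]

lemma ord_arch [CharZero L] [Algebra.IsAlgebraic ℚ L] [LinearOrder L] [IsStrictOrderedRing L] :
    Archimedean L := by
  rw [archimedean_iff_nat_lt]
  intro x
  obtain ⟨P, hP, hx⟩ : ∃ P : Polynomial ℚ, P.Monic ∧ Polynomial.aeval x P = 0 :=
    ⟨minpoly ℚ x, minpoly.monic (Algebra.IsIntegral.isIntegral x), minpoly.aeval ℚ x⟩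
  set d := P.natDegree with hd
  let C : ℚ := ∑ i ∈ Finset.range d, |P.coeff i|
  obtain ⟨n, hn⟩ := exists_nat_gt (C + 1)
  refine ⟨n, ?_⟩
  by_contra hcon
  push Not at hcon
  have hC : (C : L) + 1 < x := by
    refine lt_of_lt_of_le ?_ hcon
    have : ((C + 1 : ℚ) : L) < ((n : ℚ) : L) := Rat.cast_lt.2 hn
    push_cast at this; exact this
  have hC0 : (0 : L) ≤ (C : L) := by
    apply Rat.cast_nonneg.2
    exact Finset.sum_nonneg fun i _ => abs_nonneg _
  have hx1 : 1 ≤ x := by linarith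
  rw [Polynomial.aeval_eq_sum_range, Finset.sum_range_succ, ← hd] at hx
  have hlead : P.coeff d = 1 := hP
  rw [hlead, one_smul] at hx
  have hd0 : d ≠ 0 := by
    intro h0
    rw [h0] at hx
    simp at hx
  obtain ⟨e, he⟩ := Nat.exists_eq_succ_of_ne_zero hd0
  have h1 : -(∑ i ∈ Finset.range d, P.coeff i • x ^ i) ≤ (C : L) * x ^ e := by
    rw [← Finset.sum_neg_distrib]
    simp only [C, Rat.cast_sum, Finset.sum_mul]
    refine Finset.sum_le_sum fun i hi => ?_
    rw [Rat.smul_def]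
    have hi' : i ≤ e := by have := Finset.mem_range.1 hi; omega
    have h2 : x ^ i ≤ x ^ e := pow_le_pow_right₀ hx1 hi'
    have h3 : (0 : L) ≤ x ^ i := by positivity
    calc -((P.coeff i : L) * x ^ i) = (-(P.coeff i : L)) * x ^ i := by ring
      _ ≤ |(P.coeff i : L)| * x ^ i := mul_le_mul_of_nonneg_right (neg_le_abs _) h3
      _ ≤ |(P.coeff i : L)| * x ^ e := mul_le_mul_of_nonneg_left h2 (abs_nonneg _)
      _ = _ := by rw [Rat.cast_abs]
  have h4 : x ^ d = x * x ^ e := by rw [he, pow_succ']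
  have h5 : (0 : L) < x ^ e := by positivity
  have h6 : (C : L) * x ^ e < x * x ^ e := mul_lt_mul_of_pos_right (by linarith) h5
  linarith
end Herm

open Module TensorProduct
section Herm2
variable {K : Type*} [Field K] {L : Type*} [Field L] [Algebra K L]

lemma trB_nondeg [FiniteDimensional K L] [Algebra.IsSeparable K L] (w : L) (hw : w ≠ 0) (x : L)
    (h : ∀ y, trB K w x y = 0) : x = 0 := by
  by_contra hx
  have h1 : ∀ z, Algebra.trace K L z = 0 := fun z => by
    have := h (z * (w * x)⁻¹)
    rw [trB_apply, mul_comm z, mul_inv_cancel_left₀ (mul_ne_zero hw hx)] at this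
    exact this
  exact Algebra.trace_ne_zero K L (LinearMap.ext h1)

open Polynomial in
lemma hermite [LinearOrder K] [IsStrictOrderedRing K] [FiniteDimensional K L] [Algebra K ℂ]
    (σ : K →+* ℝ) (hσ : StrictMono σ) (hσ' : ∀ k, algebraMap K ℂ k = (σ k : ℂ))
    (θ : L) (hθ : ∀ φ φ' : L →ₐ[K] ℂ, φ θ = φ' θ → φ = φ') (w : L) (hw : w ≠ 0) :
    sg (trB K w).toQuadraticMap = ∑ φ : L →ₐ[K] ℂ, if (φ θ).im = 0 then sgw (φ w).re else 0 := by
  classical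
  have hinv : Invertible (2 : K) := invertibleOfNonzero two_ne_zero
  set Q := (trB K w).toQuadraticMap with hQ
  have hex := QuadraticForm.equivalent_weightedSumSquares Q
  obtain ⟨d, hd⟩ : ∃ d, finrank K L = d := ⟨_, rfl⟩
  rw [hd] at hex
  obtain ⟨u, ⟨e⟩⟩ := hex
  have h1 : sg Q = ∑ j, sgw (u j) := by
    rw [← sg_wss]
    exact sg_equiv _ _ e.toLinearEquiv e.map_app'
  let b : Fin d → L := fun i => e.toLinearEquiv.symm (Pi.single i 1)
  -- bilinear diagonality
  have hbil : ∀ x y : Fin d → K, trB K w (e.toLinearEquiv.symm x) (e.toLinearEquiv.symm y) = ∑ i, u i * (x i * y i) := by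
    intro x y
    have hq : ∀ x, trB K w (e.toLinearEquiv.symm x) (e.toLinearEquiv.symm x) = ∑ i, u i * (x i * x i) := by
      intro x
      have := e.map_app (e.toLinearEquiv.symm x)
      change _ = trB K w _ _ at this
      rw [← this, QuadraticMap.weightedSumSquares_apply]
      have e2 : e (e.toLinearEquiv.symm x) = x := e.toLinearEquiv.apply_symm_apply x
      rw [e2]; simp
    have h3 := hq (x + y)
    have hsy : trB K w (e.toLinearEquiv.symm x) (e.toLinearEquiv.symm y) = trB K w (e.toLinearEquiv.symm y) (e.toLinearEquiv.symm x) :=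
      (trB_symm w).eq _ _
    simp only [map_add, LinearMap.add_apply] at h3
    rw [hq x, hq y, hsy] at h3
    have h4 : ∑ i, u i * ((x + y) i * (x + y) i) = ∑ i, u i * (x i * x i) + 2 * ∑ i, u i * (x i * y i) + ∑ i, u i * (y i * y i) := by
      rw [Finset.mul_sum, ← Finset.sum_add_distrib, ← Finset.sum_add_distrib]
      refine Finset.sum_congr rfl fun i _ => ?_
      simp only [Pi.add_apply]; ring
    rw [h4] at h3
    have h5 : (2 : K) * trB K w (e.toLinearEquiv.symm y) (e.toLinearEquiv.symm x) = 2 * ∑ i, u i * (x i * y i) := by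
      linear_combination h3
    rw [hsy]
    exact mul_left_cancel₀ two_ne_zero h5
  have htr : ∀ i j, Algebra.trace K L (w * b i * b j) = if i = j then u i else 0 := by
    intro i j
    have := hbil (Pi.single i 1) (Pi.single j 1)
    rw [trB_apply] at this
    rw [show w * b i * b j = w * (e.toLinearEquiv.symm (Pi.single i 1)) * (e.toLinearEquiv.symm (Pi.single j 1)) from rfl, this]
    rw [Finset.sum_eq_single i]
    · simp [Pi.single_apply]
    · intro k _ hk; simp [hk]
    · simp
  have hu : ∀ i, u i ≠ 0 := by
    intro i hi
    have h3 : b i = 0 := by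
      apply trB_nondeg (K := K) w hw
      intro y
      obtain ⟨y, rfl⟩ := e.toLinearEquiv.symm.surjective y
      rw [hbil, Finset.sum_eq_single i]
      · simp [hi]
      · intro k _ hk; simp [hk]
      · simp
    have h4 := (LinearEquiv.map_eq_zero_iff _).1 h3
    have := congrFun h4 i
    simp at this
  let G : QuadraticForm ℝ (Fin d → ℝ) := QuadraticMap.weightedSumSquares ℝ (fun i => σ (u i))
  have h2 : sg Q = sg G := by
    rw [h1, sg_wss]
    refine Finset.sum_congr rfl fun i _ => ?_
    have a1 : 0 < σ (u i) ↔ 0 < u i := by rw [← map_zero σ, hσ.lt_iff_lt]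
    have a2 : σ (u i) < 0 ↔ u i < 0 := by rw [← map_zero σ, hσ.lt_iff_lt]
    unfold sgw
    simp only [a1, a2]
  have hrad : finrank ℝ G.radical = 0 := by
    have h3 := QuadraticForm.sigPos_add_sigNeg_add_radical (Q := G)
    rw [QuadraticForm.sigPos_weightedSumSquares, QuadraticForm.sigNeg_weightedSumSquares] at h3
    have h4 : {i | 0 < σ (u i)} ∪ {i | σ (u i) < 0} = Set.univ := by
      ext i
      have : σ (u i) ≠ 0 := by simpa using hu i
      simpa using this.symm.lt_or_gt
    have h5 := Set.ncard_union_le {i | 0 < σ (u i)} {i | σ (u i) < 0}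
    rw [h4, Set.ncard_univ] at h5
    simp at h3 h5
    omega
  let ℓ (φ : L →ₐ[K] ℂ) : (Fin d → ℝ) →ₗ[ℝ] ℂ :=
    Fintype.linearCombination ℝ (fun i => φ (b i))
  have hℓ : ∀ φ y, ℓ φ y = ∑ i, (y i : ℂ) * φ (b i) := fun φ y => by
    simp [ℓ, Fintype.linearCombination_apply]
  have hG : ∀ y, ((G y : ℝ) : ℂ) = ∑ φ : L →ₐ[K] ℂ, φ w * (ℓ φ y * ℓ φ y) := by
    intro y
    have h3 : ∀ i j, ∑ φ : L →ₐ[K] ℂ, φ (w * b i * b j) = if i = j then (σ (u i) : ℂ) else 0 := by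
      intro i j
      rw [← trace_eq_sum_embeddings, htr]
      split_ifs <;> simp [hσ']
    calc ((G y : ℝ) : ℂ) = ∑ i, ∑ j, (y i * y j : ℂ) * (if i = j then (σ (u i) : ℂ) else 0) := by
          simp only [mul_ite, mul_zero, Finset.sum_ite_eq, Finset.mem_univ, if_true, G, QuadraticMap.weightedSumSquares_apply]
          push_cast
          refine Finset.sum_congr rfl fun i _ => ?_
          simp; ring
      _ = ∑ i, ∑ j, (y i * y j : ℂ) * ∑ φ : L →ₐ[K] ℂ, φ (w * b i * b j) := by simp only [h3]
      _ = ∑ i, ∑ j, ∑ φ : L →ₐ[K] ℂ, (y i * y j : ℂ) * φ (w * b i * b j) := by simp only [Finset.mul_sum]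
      _ = ∑ φ : L →ₐ[K] ℂ, ∑ i, ∑ j, (y i * y j : ℂ) * φ (w * b i * b j) := by
          rw [Finset.sum_comm]
          rw [Finset.sum_congr rfl fun j _ => Finset.sum_comm, Finset.sum_comm]
          refine Finset.sum_congr rfl fun φ _ => ?_
          rw [Finset.sum_comm]
      _ = _ := by
          refine Finset.sum_congr rfl fun φ _ => ?_
          rw [hℓ, Finset.sum_mul_sum, Finset.mul_sum]
          refine Finset.sum_congr rfl fun i _ => ?_
          rw [Finset.mul_sum]
          refine Finset.sum_congr rfl fun j _ => ?_
          rw [map_mul, map_mul]; ring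
  -- conjugation
  let cj : (L →ₐ[K] ℂ) → (L →ₐ[K] ℂ) := fun φ =>
    { (starRingEnd ℂ).comp φ.toRingHom with
      commutes' := fun k => by
        change (starRingEnd ℂ) (φ (algebraMap K L k)) = _
        rw [φ.commutes, hσ', Complex.conj_ofReal] }
  have hcj : ∀ φ x, cj φ x = (starRingEnd ℂ) (φ x) := fun _ _ => rfl
  have hcjcj : ∀ φ, cj (cj φ) = φ := fun φ => by
    ext x; rw [hcj, hcj, Complex.conj_conj]
  have hreal : ∀ φ : L →ₐ[K] ℂ, (φ θ).im = 0 → ∀ x, (φ x).im = 0 := by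
    intro φ h x
    have h3 : cj φ = φ := hθ _ _ (by rw [hcj]; exact Complex.conj_eq_iff_im.2 h)
    rw [← Complex.conj_eq_iff_im, ← hcj, h3]
  let Up := {φ : L →ₐ[K] ℂ // 0 < (φ θ).im}
  let Rl := {φ : L →ₐ[K] ℂ // (φ θ).im = 0}
  have hcard : Fintype.card Rl + 2 * Fintype.card Up = d := by
    have h3 : Fintype.card (L →ₐ[K] ℂ) = d := by rw [← hd]; exact AlgHom.card K L ℂ
    have h4 : Fintype.card {φ : L →ₐ[K] ℂ // (φ θ).im < 0} = Fintype.card Up := by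
      refine Fintype.card_congr
        { toFun := fun φ => ⟨cj φ.1, by rw [hcj, Complex.conj_im]; linarith [φ.2]⟩
          invFun := fun φ => ⟨cj φ.1, by rw [hcj, Complex.conj_im]; linarith [φ.2]⟩
          left_inv := fun φ => Subtype.ext (hcjcj _)
          right_inv := fun φ => Subtype.ext (hcjcj _) }
    have h5 : Fintype.card Rl + (Fintype.card Up + Fintype.card {φ : L →ₐ[K] ℂ // (φ θ).im < 0}) = Fintype.card (L →ₐ[K] ℂ) := by
      rw [Fintype.card_subtype, Fintype.card_subtype, Fintype.card_subtype, ← Finset.card_union_of_disjoint, ← Finset.card_union_of_disjoint, ← Finset.card_univ]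
      · congr 1
        ext φ
        simp only [Finset.mem_union, Finset.mem_filter, Finset.mem_univ, true_and, iff_true]
        rcases lt_trichotomy 0 (φ θ).im with h | h | h
        · tauto
        · left; exact h.symm
        · tauto
      · rw [Finset.disjoint_left]
        simp only [Finset.mem_union, Finset.mem_filter, Finset.mem_univ, true_and]
        intro φ h h'
        rcases h' with h' | h' <;> linarith
      · rw [Finset.disjoint_left]
        simp only [Finset.mem_filter, Finset.mem_univ, true_and]
        intro φ h h'
        linarith
    omega
  have hc : ∀ φ : L →ₐ[K] ℂ, ∃ c : ℂ, c ≠ 0 ∧ c * c * φ w = Complex.I := by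
    intro φ
    have hw' : φ w ≠ 0 := by simpa using hw
    obtain ⟨c, hc⟩ := IsAlgClosed.exists_eq_mul_self (Complex.I / φ w)
    have h3 : c * c * φ w = Complex.I := by rw [← hc]; field_simp
    refine ⟨c, ?_, h3⟩
    rintro rfl
    simp at h3
    exact Complex.I_ne_zero h3.symm
  choose c hc0 hc using hc
  let κ : (Fin d → ℝ) →ₗ[ℝ] (Up → ℝ) :=
    LinearMap.pi fun φ => Complex.imLm ∘ₗ (LinearMap.mulRight ℝ (c φ.1)⁻¹) ∘ₗ (ℓ φ.1)
  let J := LinearMap.ker κ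
  have hJ : ∀ y ∈ J, ∀ φ : L →ₐ[K] ℂ, (φ θ).im ≠ 0 → (φ w * (ℓ φ y * ℓ φ y)).re = 0 := by
    have hup : ∀ y ∈ J, ∀ φ : L →ₐ[K] ℂ, 0 < (φ θ).im → (φ w * (ℓ φ y * ℓ φ y)).re = 0 := by
      intro y hy φ hφ
      have h3 : (ℓ φ y * (c φ)⁻¹).im = 0 := congrFun (LinearMap.mem_ker.1 hy) ⟨φ, hφ⟩
      set t := ℓ φ y * (c φ)⁻¹ with ht
      have h4 : ℓ φ y = t * c φ := by rw [ht, inv_mul_cancel_right₀ (hc0 φ)]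
      have h5 : φ w * (ℓ φ y * ℓ φ y) = t * t * Complex.I := by
        rw [h4, ← hc φ]; ring
      rw [h5]
      simp [Complex.mul_re, Complex.mul_im, h3]
    intro y hy φ hφ
    rcases lt_or_gt_of_ne hφ with h | h
    · have h3 := hup y hy (cj φ) (by rw [hcj, Complex.conj_im]; linarith)
      have h4 : ℓ (cj φ) y = (starRingEnd ℂ) (ℓ φ y) := by
        rw [hℓ, hℓ, map_sum]
        refine Finset.sum_congr rfl fun i _ => ?_
        rw [map_mul, Complex.conj_ofReal, hcj]
      rw [h4, hcj, ← map_mul, ← map_mul, Complex.conj_re] at h3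
      exact h3
    · exact hup y hy φ h
  let ρ : J →ₗ[ℝ] (Rl → ℝ) :=
    LinearMap.pi fun φ => Complex.reLm ∘ₗ (ℓ φ.1) ∘ₗ J.subtype
  let ψ : QuadraticForm ℝ (Rl → ℝ) := QuadraticMap.weightedSumSquares ℝ (fun φ => (φ.1 w).re)
  have hred : sg G = sg ψ := by
    refine sg_red G ψ J.subtype ρ ?_ ?_
    · rintro ⟨y, hy⟩
      have h3 := congrArg Complex.re (hG y)
      rw [Complex.ofReal_re, Complex.re_sum] at h3
      change G y = _
      rw [h3, QuadraticMap.weightedSumSquares_apply]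
      rw [← Finset.sum_filter_add_sum_filter_not Finset.univ (fun φ : L →ₐ[K] ℂ => (φ θ).im = 0)]
      rw [Finset.sum_eq_zero (s := Finset.univ.filter (fun φ : L →ₐ[K] ℂ => ¬ (φ θ).im = 0)), add_zero]
      · rw [Finset.sum_subtype (p := fun φ : L →ₐ[K] ℂ => (φ θ).im = 0) _ (by simp)]
        refine Finset.sum_congr rfl fun φ _ => ?_
        have h6 : (ℓ φ.1 y).im = 0 := by
          rw [hℓ, Complex.im_sum]
          refine Finset.sum_eq_zero fun i _ => ?_
          rw [Complex.im_ofReal_mul, hreal φ.1 φ.2, mul_zero]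
        have h7 := hreal φ.1 φ.2 w
        change _ = (φ.1 w).re • ((ℓ φ.1 y).re * (ℓ φ.1 y).re)
        simp [Complex.mul_re, Complex.mul_im, h6, h7]
      · intro φ hφ
        exact hJ y hy φ (Finset.mem_filter.1 hφ).2
    · rw [hrad, Submodule.range_subtype]
      have h3 := LinearMap.finrank_range_add_finrank_ker κ
      have h4 := Submodule.finrank_le (LinearMap.range κ)
      simp only [Module.finrank_fintype_fun_eq_card, Fintype.card_fin] at h3 h4 ⊢
      change _ + finrank ℝ J = _ at h3
      omega
  rw [h2, hred, sg_wss]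
  rw [← Finset.sum_filter, Finset.sum_subtype (p := fun φ : L →ₐ[K] ℂ => (φ θ).im = 0) _ (by simp)]
end Herm2

open Module TensorProduct
section Herm3
variable {K : Type*} [Field K] {L : Type*} [Field L] [Algebra K L]

lemma sgw_mul_pos {F : Type*} [Field F] [LinearOrder F] [IsStrictOrderedRing F] (a b : F) (h : 0 < a) :
    sgw (a * b) = sgw b := by
  have a1 : 0 < a * b ↔ 0 < b := mul_pos_iff_of_pos_left h
  have a2 : a * b < 0 ↔ b < 0 := by
    constructor
    · intro h2; by_contra h3; push Not at h3; have := mul_nonneg h.le h3; linarith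
    · intro h2; exact mul_neg_of_pos_of_neg h h2
  unfold sgw; simp only [a1, a2]

lemma sgw_neg {F : Type*} [Field F] [LinearOrder F] [IsStrictOrderedRing F] (b : F) :
    sgw (-b) = - sgw b := by
  unfold sgw
  rcases lt_trichotomy 0 b with h | h | h
  · simp [h, h.le, not_lt.2 h.le]
  · simp [← h]
  · simp [h, h.le, not_lt.2 h.le]

lemma sep_nf [NumberField K] [FiniteDimensional K L] {ι : Type*} [Fintype ι] (w : ι → L) (hw : ∀ i, w i ≠ 0)
    (h : ∀ O : FieldOrdering K, ∀ g : L, g ≠ 0 → ∑ i, signatureAt O (fun x => trB K (g * w i) x x) = 0)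
    (O : FieldOrdering L) : ∑ i, osgn O (w i) = 0 := by
  classical
  have hcz := ord_charZero O
  haveI : Algebra.IsAlgebraic K L := inferInstance
  haveI : IsScalarTower ℚ K L := inferInstance
  haveI : Algebra.IsAlgebraic ℚ L := Algebra.IsAlgebraic.trans ℚ K L
  letI := O.lo
  haveI := O.so
  haveI : Archimedean L := ord_arch
  let τ : L →+*o ℝ := LinearOrderedField.inducedOrderRingHom L ℝ
  have hτ : StrictMono τ := τ.monotone'.strictMono_of_injective τ.toRingHom.injective
  let σ : K →+* ℝ := τ.toRingHom.comp (algebraMap K L)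
  letI : Algebra K ℂ := (Complex.ofRealHom.comp σ).toAlgebra
  have hσ' : ∀ k, algebraMap K ℂ k = (σ k : ℂ) := fun k => rfl
  let φ0 : L →ₐ[K] ℂ := { Complex.ofRealHom.comp τ.toRingHom with commutes' := fun k => rfl }
  have hφ0 : ∀ x, φ0 x = (τ x : ℂ) := fun x => rfl
  let pb := Field.powerBasisOfFiniteOfSeparable K L
  let θ := pb.gen
  have hθ : ∀ φ φ' : L →ₐ[K] ℂ, φ θ = φ' θ → φ = φ' := fun φ φ' h => pb.algHom_ext h
  have key : ∀ g : L, g ≠ 0 → ∑ i, ∑ φ : L →ₐ[K] ℂ, (if (φ θ).im = 0 then sgw (φ (g * w i)).re else 0) = 0 := by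
    intro g hg
    refine Eq.trans ?_ (h (O.comap K) g hg)
    refine Finset.sum_congr rfl fun i _ => ?_
    have h2 := signatureAt_eq (O.comap K) (trB K (g * w i)).toQuadraticMap
    simp only [LinearMap.BilinMap.toQuadraticMap_apply] at h2
    rw [h2]
    letI := (O.comap K).lo
    haveI := (O.comap K).so
    symm
    refine hermite σ ?_ hσ' θ hθ (g * w i) (mul_ne_zero hg (hw i))
    intro a b hab
    apply hτ
    change algebraMap K L b - algebraMap K L a ∈ O.carrier
    rw [← map_sub]
    exact hab
  -- separating element
  let S : Set ℝ := Set.range fun φ : {φ : L →ₐ[K] ℂ // (φ θ).im = 0 ∧ φ ≠ φ0} => (φ.1 θ).re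
  have hS : τ θ ∉ S := by
    rintro ⟨⟨φ, h1, h2⟩, h3⟩
    apply h2
    apply hθ
    rw [hφ0]
    apply Complex.ext
    · simpa using h3
    · simpa using h1
  obtain ⟨ε, hε, hball⟩ := Metric.isOpen_iff.1 (Set.finite_range _).isClosed.isOpen_compl (τ θ) hS
  obtain ⟨a, ha1, ha2⟩ := exists_rat_btwn (show τ θ - ε < τ θ by linarith)
  obtain ⟨b, hb1, hb2⟩ := exists_rat_btwn (show τ θ < τ θ + ε by linarith)
  let g : L := (θ - (a : L)) * ((b : L) - θ)
  have hg0 : 0 < τ g := by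
    simp only [g, map_mul, map_sub, map_ratCast]
    apply mul_pos <;> linarith
  have hg : g ≠ 0 := by
    intro h0; rw [h0, map_zero] at hg0; exact lt_irrefl _ hg0
  have hsum := congrArg₂ (· + ·) (key 1 one_ne_zero) (key g hg)
  simp only [← Finset.sum_add_distrib] at hsum
  have hterm : ∀ i, ∑ φ : L →ₐ[K] ℂ, ((if (φ θ).im = 0 then sgw (φ (1 * w i)).re else 0) + (if (φ θ).im = 0 then sgw (φ (g * w i)).re else 0)) = 2 * osgn O (w i) := by
    intro i
    rw [Finset.sum_eq_single φ0]
    · have h1 : (φ0 θ).im = 0 := by rw [hφ0]; simp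
      rw [if_pos h1, if_pos h1, hφ0, hφ0, one_mul, Complex.ofReal_re, Complex.ofReal_re, map_mul, sgw_mul_pos _ _ hg0, osgn_eq]
      have a1 : 0 < τ (w i) ↔ 0 < w i := by rw [← map_zero τ, hτ.lt_iff_lt]
      have a2 : τ (w i) < 0 ↔ w i < 0 := by rw [← map_zero τ, hτ.lt_iff_lt]
      have : sgw (τ (w i)) = sgw (w i) := by unfold sgw; simp only [a1, a2]
      rw [this]; ring
    · intro φ _ hφ
      by_cases h1 : (φ θ).im = 0
      · rw [if_pos h1, if_pos h1, one_mul, map_mul]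
        have hmem : (φ θ).re ∈ S := ⟨⟨φ, h1, hφ⟩, rfl⟩
        have hfar : ε ≤ |(φ θ).re - τ θ| := by
          by_contra hlt
          push Not at hlt
          exact hball (by rw [Metric.mem_ball, Real.dist_eq]; exact hlt) hmem
        have hgim : (φ g).im = 0 := by
          simp [g, map_mul, map_sub, Complex.mul_im, h1]
        have hgre : (φ g).re < 0 := by
          have : (φ g).re = ((φ θ).re - a) * (b - (φ θ).re) := by
            simp [g, map_mul, map_sub, Complex.mul_re, h1]
          rw [this]
          rcases le_abs.1 hfar with h3 | h3
          · apply mul_neg_of_pos_of_neg <;> linarith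
          · apply mul_neg_of_neg_of_pos <;> linarith
        have h4 : (φ g * φ (w i)).re = -((-(φ g).re) * (φ (w i)).re) := by
          rw [Complex.mul_re, hgim]; ring
        rw [h4, sgw_neg, sgw_mul_pos _ _ (by linarith)]; ring
      · rw [if_neg h1, if_neg h1]; rfl
    · simp
  rw [Finset.sum_congr rfl fun i _ => hterm i, ← Finset.mul_sum] at hsum
  simpa using hsum

lemma sep_all (hK : NumberField K ∨ IsRealClosedField K) [FiniteDimensional K L] {ι : Type*} [Fintype ι] (w : ι → L) (hw : ∀ i, w i ≠ 0)
    (h : ∀ O : FieldOrdering K, ∀ g : L, g ≠ 0 → ∑ i, signatureAt O (fun x => trB K (g * w i) x x) = 0)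
    (O : FieldOrdering L) : ∑ i, osgn O (w i) = 0 := by
  rcases hK with hK | hK
  · exact sep_nf w hw h O
  · exact sep_rc hK w h O
end Herm3

open Module TensorProduct
section E1
open Polynomial
variable {K : Type*} [Field K] (p : K[X]) (k : ℕ)

/-- residue map -/
noncomputable def rhoE (hk : 1 ≤ k) : AdjoinRoot (p ^ k) →ₐ[K] AdjoinRoot p :=
  AdjoinRoot.liftAlgHom (p ^ k) (Algebra.ofId K _) (AdjoinRoot.root p) (by
    have : eval₂ ((Algebra.ofId K (AdjoinRoot p) : K →ₐ[K] AdjoinRoot p) : K →+* AdjoinRoot p) (AdjoinRoot.root p) p = 0 := AdjoinRoot.eval₂_root p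
    rw [eval₂_pow, this, zero_pow (by omega)])

variable (hk : 1 ≤ k)

lemma rhoE_mk (f : K[X]) : rhoE p k hk (AdjoinRoot.mk _ f) = AdjoinRoot.mk p f := by
  rw [← AdjoinRoot.aeval_eq, ← AdjoinRoot.aeval_eq, ← Polynomial.aeval_algHom_apply]
  congr 2
  exact AdjoinRoot.liftAlgHom_root _ _ _ _

lemma rhoE_surj : Function.Surjective (rhoE p k hk) := by
  intro x
  obtain ⟨f, rfl⟩ := AdjoinRoot.mk_surjective x
  exact ⟨_, rhoE_mk p k hk f⟩

lemma rhoE_zero (x : AdjoinRoot (p ^ k)) : rhoE p k hk x = 0 ↔ ∃ y, x = AdjoinRoot.mk _ p * y := by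
  obtain ⟨f, rfl⟩ := AdjoinRoot.mk_surjective x
  rw [rhoE_mk, AdjoinRoot.mk_eq_zero]
  constructor
  · rintro ⟨g, rfl⟩
    exact ⟨AdjoinRoot.mk _ g, by rw [map_mul]⟩
  · rintro ⟨y, hy⟩
    obtain ⟨g, rfl⟩ := AdjoinRoot.mk_surjective y
    rw [← map_mul, AdjoinRoot.mk_eq_mk] at hy
    have h1 : p ∣ f - p * g := (dvd_pow_self p (by omega)).trans hy
    exact (dvd_sub_left (dvd_mul_right p g)).1 h1

lemma pi_pow_k : (AdjoinRoot.mk (p ^ k) p) ^ k = 0 := by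
  rw [← map_pow, AdjoinRoot.mk_self]

lemma rhoE_nilp (x : AdjoinRoot (p ^ k)) (h : rhoE p k hk x = 0) : IsNilpotent x := by
  obtain ⟨y, rfl⟩ := (rhoE_zero p k hk x).1 h
  exact ⟨k, by rw [mul_pow, pi_pow_k, zero_mul]⟩


lemma pi_ker (hp : Irreducible p) (x : AdjoinRoot (p ^ k)) (h : AdjoinRoot.mk _ p ^ (k-1) * x = 0) : rhoE p k hk x = 0 := by
  obtain ⟨f, rfl⟩ := AdjoinRoot.mk_surjective x
  rw [← map_pow, ← map_mul, AdjoinRoot.mk_eq_zero] at h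
  rw [rhoE_mk, AdjoinRoot.mk_eq_zero]
  have : p ^ k = p ^ (k-1) * p := by rw [← pow_succ]; congr 1; omega
  rw [this] at h
  exact (mul_dvd_mul_iff_left (pow_ne_zero _ hp.ne_zero)).1 h

lemma unit_mk (hp : Irreducible p) (u : K[X]) (hu : ¬ p ∣ u) : IsUnit (AdjoinRoot.mk (p^k) u) := by
  have h : IsCoprime u (p^k) := ((hp.coprime_iff_not_dvd.2 hu).symm).pow_right
  obtain ⟨a, b, hab⟩ := h
  have := congrArg (AdjoinRoot.mk (p^k)) hab
  rw [map_add, map_mul, map_mul, AdjoinRoot.mk_self, mul_zero, add_zero, map_one] at this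
  exact IsUnit.of_mul_eq_one _ (by rw [mul_comm]; exact this)

lemma soc_ex (hp : Irreducible p) (x : AdjoinRoot (p ^ k)) (hx : x ≠ 0) : ∃ y, x * y = AdjoinRoot.mk _ p ^ (k-1) := by
  obtain ⟨f, rfl⟩ := AdjoinRoot.mk_surjective x
  have hf : f ≠ 0 := by rintro rfl; simp at hx
  obtain ⟨j, u, hu, rfl⟩ := WfDvdMonoid.max_power_factor hf hp
  have hj : j < k := by
    by_contra h
    apply hx
    rw [AdjoinRoot.mk_eq_zero]
    exact (pow_dvd_pow p (by omega)).mul_right u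
  obtain ⟨v, hv⟩ := (unit_mk p k hp u hu).exists_right_inv
  refine ⟨AdjoinRoot.mk _ p ^ (k-1-j) * v, ?_⟩
  rw [map_mul, map_pow]
  calc _ = AdjoinRoot.mk (p^k) p ^ j * AdjoinRoot.mk (p^k) p ^ (k-1-j) * (AdjoinRoot.mk (p^k) u * v) := by ring
    _ = _ := by rw [hv, mul_one, ← pow_add]; congr 1; omega

lemma finrank_RR (hp : Irreducible p) (hm : p.Monic) : finrank K (AdjoinRoot (p ^ k)) = k * p.natDegree := by
  rw [(AdjoinRoot.powerBasis' (hm.pow k)).finrank, AdjoinRoot.powerBasis'_dim, hm.natDegree_pow]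

lemma rank_pip (hp : Irreducible p) (hm : p.Monic) (c : ℕ) (hc : c ≤ k) : (k - c) * p.natDegree ≤
    finrank K (LinearMap.range (LinearMap.mulLeft K (AdjoinRoot.mk (p^k) p ^ c))) := by
  haveI : Module.Finite K (AdjoinRoot (p^k)) := (hm.pow k).finite_adjoinRoot
  haveI : Module.Finite K (AdjoinRoot (p^(k-c))) := (hm.pow _).finite_adjoinRoot
  let h : AdjoinRoot (p^(k-c)) →ₗ[K] AdjoinRoot (p^k) :=
    LinearMap.mulLeft K (AdjoinRoot.mk (p^k) p ^ c) ∘ₗ (AdjoinRoot.mkₐ (p^k)).toLinearMap ∘ₗ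
      ((AdjoinRoot.modByMonicHom (hm.pow (k-c))).restrictScalars K)
  have hle : LinearMap.range h ≤ LinearMap.range (LinearMap.mulLeft K (AdjoinRoot.mk (p^k) p ^ c)) :=
    LinearMap.range_comp_le_range _ _
  have hinj : Function.Injective h := by
    rw [← LinearMap.ker_eq_bot, LinearMap.ker_eq_bot']
    intro x hx
    have h1 := AdjoinRoot.mk_leftInverse (hm.pow (k-c)) x
    rw [← h1, AdjoinRoot.mk_eq_zero]
    set f := AdjoinRoot.modByMonicHom (hm.pow (k-c)) x with hf
    have h2 : AdjoinRoot.mk (p^k) p ^ c * AdjoinRoot.mk (p^k) f = 0 := hx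
    rw [← map_pow, ← map_mul, AdjoinRoot.mk_eq_zero, show p^k = p^c * p^(k-c) by rw [← pow_add]; congr 1; omega] at h2
    exact (mul_dvd_mul_iff_left (pow_ne_zero _ hp.ne_zero)).1 h2
  have := Submodule.finrank_mono hle
  rw [LinearMap.finrank_range_of_inj hinj, finrank_RR p _ hp hm] at this
  exact this
end E1

open Module TensorProduct
section E2
open Polynomial

/-- bilinear form attached to a functional -/
noncomputable def sB {K R : Type*} [Field K] [CommRing R] [Algebra K R] (s : R →ₗ[K] K) (a : R) :
    LinearMap.BilinForm K R := (LinearMap.mul K R).compr₂ (s ∘ₗ LinearMap.mulLeft K a)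

lemma sB_apply {K R : Type*} [Field K] [CommRing R] [Algebra K R] (s : R →ₗ[K] K) (a x y : R) :
    sB s a x y = s (a * (x * y)) := rfl

lemma sB_symm {K R : Type*} [Field K] [CommRing R] [Algebra K R] (s : R →ₗ[K] K) (a : R) :
    (sB s a).IsSymm := ⟨fun x y => by simp [sB_apply, mul_comm x y]⟩

variable {K : Type*} [Field K] (p : K[X]) (k : ℕ)

lemma iota_ex [CharZero K] [hp : Fact (Irreducible p)] (hk : 1 ≤ k) :
    ∃ ι : AdjoinRoot p →ₐ[K] AdjoinRoot (p ^ k), ∀ x, rhoE p k hk (ι x) = x := by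
  have h1 : IsNilpotent (aeval (AdjoinRoot.root (p^k)) p) := by
    rw [AdjoinRoot.aeval_eq]
    exact ⟨k, pi_pow_k p k⟩
  have h2 : IsUnit (aeval (AdjoinRoot.root (p^k)) (derivative p)) := by
    rw [AdjoinRoot.aeval_eq]
    apply unit_mk p k hp.out
    intro h
    have h3 := degree_le_of_dvd h (by
      intro h0
      have := natDegree_eq_zero_of_derivative_eq_zero h0
      exact absurd hp.out.natDegree_pos (by omega))
    exact absurd (degree_derivative_lt hp.out.ne_zero) (not_lt.2 h3)
  obtain ⟨r, ⟨hr1, hr2⟩, -⟩ := Polynomial.existsUnique_nilpotent_sub_and_aeval_eq_zero h1 h2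
  refine ⟨AdjoinRoot.liftAlgHom p (Algebra.ofId K _) r hr2, fun x => ?_⟩
  have : ((rhoE p k hk).comp (AdjoinRoot.liftAlgHom p (Algebra.ofId K _) r hr2)) = AlgHom.id K _ := by
    apply AdjoinRoot.algHom_ext
    have h3 : rhoE p k hk r = AdjoinRoot.root p := by
      have := (hr1.map (rhoE p k hk)).eq_zero
      rw [map_sub, sub_eq_zero] at this
      rw [← this]
      have := rhoE_mk p k hk X
      simpa using this
    exact (congrArg (rhoE p k hk) (AdjoinRoot.liftAlgHom_root p (Algebra.ofId K _) r hr2)).trans h3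
  exact DFunLike.congr_fun this x

lemma sq_ex [CharZero K] [hp : Fact (Irreducible p)] (hk : 1 ≤ k) (a : AdjoinRoot (p^k)) (ha : rhoE p k hk a = 1) :
    ∃ v, IsUnit v ∧ v * v = a := by
  have hnil := rhoE_nilp p k hk (1 - a) (by rw [map_sub, map_one, ha, sub_self])
  have h1 : IsNilpotent (aeval (1 : AdjoinRoot (p^k)) (X^2 - C a : (AdjoinRoot (p^k))[X])) := by
    simpa using hnil
  have h2 : IsUnit (aeval (1 : AdjoinRoot (p^k)) (derivative (X^2 - C a : (AdjoinRoot (p^k))[X]))) := by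
    have : IsUnit (algebraMap K (AdjoinRoot (p^k)) 2) := (isUnit_iff_ne_zero.2 two_ne_zero).map _
    rw [map_ofNat] at this
    simpa [one_add_one_eq_two] using this
  obtain ⟨r, ⟨hr1, hr2⟩, -⟩ := Polynomial.existsUnique_nilpotent_sub_and_aeval_eq_zero h1 h2
  refine ⟨r, ?_, ?_⟩
  · have := hr1.isUnit_one_sub
    simpa using this
  · have : r^2 - a = 0 := by simpa using hr2
    rw [← sq]; exact sub_eq_zero.1 this

lemma s0_ex [CharZero K] [hp : Fact (Irreducible p)] (hk : 1 ≤ k) :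
    ∃ s0 : AdjoinRoot (p^k) →ₗ[K] K, ∀ x, s0 (AdjoinRoot.mk _ p ^ (k-1) * x) = Algebra.trace K _ (rhoE p k hk x) := by
  have h := LinearMap.range_dualMap_eq_dualAnnihilator_ker (LinearMap.mulLeft K (AdjoinRoot.mk (p^k) p ^ (k-1)))
  have h2 : (Algebra.trace K _ ∘ₗ (rhoE p k hk).toLinearMap) ∈ (LinearMap.ker (LinearMap.mulLeft K (AdjoinRoot.mk (p^k) p ^ (k-1)))).dualAnnihilator := by
    rw [Submodule.mem_dualAnnihilator]
    intro x hx
    have := pi_ker p k hk hp.out x hx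
    simp [this]
  rw [← h] at h2
  obtain ⟨s0, hs⟩ := h2
  exact ⟨s0, fun x => LinearMap.congr_fun hs x⟩

theorem local_nf [CharZero K] [hp : Fact (Irreducible p)] (hm : p.Monic) (hk : 1 ≤ k) :
    ∃ (s0 : AdjoinRoot (p^k) →ₗ[K] K) (ι : AdjoinRoot p →ₐ[K] AdjoinRoot (p^k)),
      (∀ s : AdjoinRoot (p^k) →ₗ[K] K, (∀ x, x ≠ 0 → ∃ y, s (x * y) ≠ 0) →
        ∃ (w : AdjoinRoot p) (v : AdjoinRoot (p^k)), w ≠ 0 ∧ IsUnit v ∧ ∀ x, s x = s0 (ι w * (v * v) * x)) ∧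
      ∀ (O : FieldOrdering K) (j : ℕ) (g : K[X]) (w : AdjoinRoot p), ¬ p ∣ g → w ≠ 0 →
        signatureAt O (fun x => sB s0 (ι w * AdjoinRoot.mk _ (p^j * g)) x x) =
          if j < k ∧ Odd (k - j) then signatureAt O (fun x => trB K (AdjoinRoot.mk p g * w) x x) else 0 := by
  haveI : Module.Finite K (AdjoinRoot (p^k)) := (hm.pow k).finite_adjoinRoot
  haveI : Module.Finite K (AdjoinRoot p) := hm.finite_adjoinRoot
  obtain ⟨ι, hι⟩ := iota_ex p k hk
  obtain ⟨s0, hs0⟩ := s0_ex p k hk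
  set π := AdjoinRoot.mk (p^k) p with hπ
  have hιu : ∀ w : AdjoinRoot p, w ≠ 0 → IsUnit (ι w) := fun w hw => (isUnit_iff_ne_zero.2 hw).map ι
  -- nondegeneracy
  have hnd : ∀ x, x ≠ 0 → ∃ y, s0 (x * y) ≠ 0 := by
    intro x hx
    obtain ⟨y, hy⟩ := soc_ex p k hp.out x hx
    have : Algebra.trace K (AdjoinRoot p) 1 ≠ 0 := by
      rw [← map_one (algebraMap K (AdjoinRoot p)), Algebra.trace_algebraMap]
      simp [Module.finrank_pos.ne']
    exact ⟨y, by rw [hy, ← hπ, ← mul_one (π ^ _), hs0, map_one]; exact this⟩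
  refine ⟨s0, ι, ?_, ?_⟩
  · intro s hs
    let D : AdjoinRoot (p^k) →ₗ[K] Module.Dual K (AdjoinRoot (p^k)) := (LinearMap.mul K _).compr₂ s0
    have hD : Function.Injective D := by
      rw [← LinearMap.ker_eq_bot, LinearMap.ker_eq_bot']
      intro x hx
      by_contra h
      obtain ⟨y, hy⟩ := hnd x h
      exact hy (LinearMap.congr_fun hx y)
    obtain ⟨U, hU⟩ := (LinearMap.injective_iff_surjective_of_finrank_eq_finrank (Subspace.dual_finrank_eq).symm).1 hD s
    have hU' : ∀ x, s x = s0 (U * x) := fun x => (LinearMap.congr_fun hU x).symm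
    have hw : rhoE p k hk U ≠ 0 := by
      intro h
      obtain ⟨z, hz⟩ := (rhoE_zero p k hk U).1 h
      have hne : π ^ (k-1) ≠ 0 := by
        intro h0
        have := pi_ker p k hk hp.out 1 (by rw [← hπ, h0, zero_mul])
        rw [map_one] at this
        exact one_ne_zero this
      obtain ⟨y, hy⟩ := hs _ hne
      apply hy
      rw [hU', hz, show AdjoinRoot.mk (p^k) p * z * (π^(k-1) * y) = π^(k-1+1) * (z * y) by rw [pow_succ, hπ]; ring,
        Nat.sub_add_cancel hk, hπ, pi_pow_k, zero_mul, map_zero]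
    obtain ⟨v, hv, hv2⟩ := sq_ex p k hk (ι (rhoE p k hk U)⁻¹ * U) (by
      rw [map_mul, hι, inv_mul_cancel₀ hw])
    refine ⟨_, v, hw, hv, fun x => ?_⟩
    rw [hU', hv2, ← mul_assoc, ← map_mul, mul_inv_cancel₀ hw, map_one, one_mul]
  · intro O j g w hg hw
    have h1 := signatureAt_eq O (sB s0 (ι w * AdjoinRoot.mk _ (p^j * g))).toQuadraticMap
    have h2 := signatureAt_eq O (trB K (AdjoinRoot.mk p g * w)).toQuadraticMap
    simp only [LinearMap.BilinMap.toQuadraticMap_apply] at h1 h2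
    rw [h1, h2]
    letI := O.lo
    haveI := O.so
    change sg _ = if j < k ∧ Odd (k-j) then sg _ else 0
    obtain ⟨d, hd⟩ : ∃ d, d = p.natDegree := ⟨_, rfl⟩
    have hdR := finrank_RR p k hp.out hm
    have hRk : ∀ c ≤ k, (k - c) * d ≤ finrank K (LinearMap.range (LinearMap.mulLeft K (π ^ c))) :=
      fun c hc => hd ▸ rank_pip p k hp.out hm c hc
    rw [← hd] at hdR
    have hdL : finrank K (AdjoinRoot p) = d := by
      rw [(AdjoinRoot.powerBasis' hm).finrank, AdjoinRoot.powerBasis'_dim, hd]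
    have hrad : j ≤ k → finrank K (sB s0 (ι w * AdjoinRoot.mk _ (p^j * g))).toQuadraticMap.radical ≤ j * d := by
      intro hj
      have hle : (sB s0 (ι w * AdjoinRoot.mk _ (p^j * g))).toQuadraticMap.radical ≤
          LinearMap.ker (LinearMap.mulLeft K (π ^ j)) := by
        intro x hx
        rw [mem_rad _ (sB_symm _ _)] at hx
        rw [LinearMap.mem_ker, LinearMap.mulLeft_apply]
        by_contra h
        have hu : IsUnit (ι w * AdjoinRoot.mk (p^k) g) := (hιu w hw).mul (unit_mk p k hp.out g hg)
        have : (ι w * AdjoinRoot.mk (p^k) g) * (π ^ j * x) ≠ 0 := fun h0 => h (hu.mul_right_eq_zero.1 h0)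
        obtain ⟨y, hy⟩ := hnd _ this
        apply hy
        rw [← hx y, sB_apply, map_mul (AdjoinRoot.mk (p^k)), map_pow]
        congr 1; ring
      have h3 := Submodule.finrank_mono hle
      have h4 := LinearMap.finrank_range_add_finrank_ker (LinearMap.mulLeft K (π ^ j))
      have h5 := hRk j hj
      rw [hdR] at h4
      obtain ⟨e, rfl⟩ := Nat.exists_eq_add_of_le hj
      rw [Nat.add_sub_cancel_left] at h5
      rw [add_mul] at h4
      omega
    split_ifs with hif
    · obtain ⟨hjk, c, hc⟩ := hif
      obtain rfl : k = j + 2 * c + 1 := by omega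
      apply sg_red _ _ (LinearMap.mulLeft K (π ^ c)) (rhoE p _ hk).toLinearMap
      · intro x
        simp only [LinearMap.BilinMap.toQuadraticMap_apply, sB_apply, trB_apply, LinearMap.mulLeft_apply, AlgHom.toLinearMap_apply]
        rw [show ι w * AdjoinRoot.mk (p ^ (j + 2 * c + 1)) (p ^ j * g) * (π ^ c * x * (π ^ c * x)) =
          π ^ (j + 2 * c + 1 - 1) * (ι w * AdjoinRoot.mk _ g * x * x) by
            rw [Nat.add_sub_cancel, map_mul, map_pow]; ring, hs0]
        simp only [map_mul, hι, rhoE_mk]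
        congr 1; ring
      · have h5 := hRk c (show c ≤ j + 2 * c + 1 by omega)
        have h6 := hrad (by omega)
        rw [hdR, hdL]
        rw [show j + 2 * c + 1 - c = j + c + 1 by omega] at h5
        ring_nf at h5 h6 ⊢
        omega
    · rw [← sg_sub (0 : QuadraticForm K PUnit)]
      by_cases hjk : j < k
      · have : Even (k - j) := Nat.not_odd_iff_even.1 fun h => hif ⟨hjk, h⟩
        obtain ⟨c, hc⟩ := this
        obtain rfl : k = j + 2 * c := by omega
        apply sg_red _ _ (LinearMap.mulLeft K (π ^ c)) 0
        · intro x
          simp only [LinearMap.BilinMap.toQuadraticMap_apply, sB_apply, LinearMap.mulLeft_apply]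
          rw [show ι w * AdjoinRoot.mk (p ^ (j + 2 * c)) (p ^ j * g) * (π ^ c * x * (π ^ c * x)) =
            π ^ (j + 2 * c) * (ι w * AdjoinRoot.mk _ g * x * x) by
            rw [map_mul, map_pow]; ring, pi_pow_k]
          simp
        · have h5 := hRk c (show c ≤ j + 2 * c by omega)
          have h6 := hrad (by omega)
          rw [hdR, finrank_zero_of_subsingleton]
          rw [show j + 2 * c - c = j + c by omega] at h5
          ring_nf at h5 h6 ⊢
          omega
      · apply sg_red _ _ LinearMap.id 0
        · intro x
          obtain ⟨e, rfl⟩ := Nat.exists_eq_add_of_le (not_lt.1 hjk)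
          simp only [LinearMap.BilinMap.toQuadraticMap_apply, sB_apply]
          rw [pow_add, map_mul (AdjoinRoot.mk (p^k)), map_mul (AdjoinRoot.mk (p^k)), AdjoinRoot.mk_self]
          simp
        · rw [finrank_zero_of_subsingleton, LinearMap.range_id, finrank_top]
          have := Submodule.finrank_le (sB s0 (ι w * AdjoinRoot.mk _ (p^j * g))).toQuadraticMap.radical
          omega
end E2

open Module TensorProduct
section D1
open Polynomial
universe u v
/-- elementary divisor classes -/
abbrev PK (K : Type*) [Field K] := {c : K[X] × ℕ // c.1.Monic ∧ Irreducible c.1 ∧ 1 ≤ c.2}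

/-- the local algebra of a class -/
abbrev RR {K : Type*} [Field K] (c : PK K) := AdjoinRoot (c.1.1 ^ c.1.2)

/-- the residue field of a class -/
abbrev LL {K : Type*} [Field K] (c : PK K) := AdjoinRoot (c.1.1)

instance factPK {K : Type*} [Field K] (c : PK K) : Fact (Irreducible c.1.1) := ⟨c.2.2.1⟩

instance finRR {K : Type*} [Field K] (c : PK K) : Module.Finite K (RR c) := (c.2.1.pow _).finite_adjoinRoot

instance finLL {K : Type*} [Field K] (c : PK K) : Module.Finite K (LL c) := (c.2.1).finite_adjoinRoot

variable {K : Type u} [Field K] {V : Type v} [AddCommGroup V] [Module K V]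

lemma sa_aeval (q : LinearMap.BilinForm K V) (T : Module.End K V) (hT : ∀ x y, q (T x) y = q x (T y))
    (f : K[X]) (x y : V) : q (aeval T f x) y = q x (aeval T f y) := by
  have key : ∀ n x y, q ((T ^ n) x) y = q x ((T ^ n) y) := by
    intro n
    induction n with
    | zero => simp
    | succ n ih => intro x y; rw [pow_succ, Module.End.mul_apply, ih, hT, ← Module.End.mul_apply, ← pow_succ', pow_succ]
  induction f using Polynomial.induction_on' with
  | add f g hf hg => simp [hf, hg]
  | monomial n a => simp [aeval_monomial, key, Algebra.algebraMap_eq_smul_one]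

lemma cyc_step [CharZero K] [FiniteDimensional K V] [Nontrivial V] (q : LinearMap.BilinForm K V) (hs : q.IsSymm)
    (hn : q.Nondegenerate) (T : Module.End K V) (hT : ∀ x y, q (T x) y = q x (T y)) :
    ∃ (c : PK K) (Φ : RR c →ₗ[K] V) (s : RR c →ₗ[K] K),
      (∀ f, Φ (AdjoinRoot.root _ * f) = T (Φ f)) ∧ (∀ f g, q (Φ f) (Φ g) = s (f * g)) ∧
      ∀ a, a ≠ 0 → ∃ y, s (a * y) ≠ 0 := by
  set m := minpoly K T with hm
  have hint : IsIntegral K T := Algebra.IsIntegral.isIntegral T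
  have hm0 : m ≠ 0 := minpoly.ne_zero hint
  obtain ⟨p, hpm, hpi, hpd⟩ := Polynomial.exists_monic_irreducible_factor m (minpoly.not_isUnit K T)
  obtain ⟨k, m0, hm1, hm2⟩ := WfDvdMonoid.max_power_factor hm0 hpi
  have hk : 1 ≤ k := by
    by_contra h
    obtain rfl : k = 0 := by omega
    rw [pow_zero, one_mul] at hm2
    exact hm1 (hm2 ▸ hpd)
  have hmT : aeval T m = 0 := minpoly.aeval K T
  have hpk : p ^ k = p ^ (k-1) * p := by rw [← pow_succ]; congr 1; omega
  have hh : aeval T (p^(k-1) * m0) ≠ 0 := by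
    intro h
    have h1 := minpoly.dvd K T h
    rw [← hm, hm2, hpk] at h1
    have h2 : p^(k-1) * m0 * p ∣ p^(k-1) * m0 * 1 := by
      rw [mul_one, mul_right_comm]; exact h1
    have hm00 : m0 ≠ 0 := by rintro rfl; simp at hm1
    exact hpi.not_isUnit (isUnit_of_dvd_one ((mul_dvd_mul_iff_left (mul_ne_zero (pow_ne_zero _ hpi.ne_zero) hm00)).1 h2))
  obtain ⟨x0, hx0⟩ : ∃ x0, q (aeval T (p^(k-1) * m0) x0) x0 ≠ 0 := by
    haveI : Invertible (2 : K) := invertibleOfNonzero two_ne_zero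
    have hB : (q.compLeft (aeval T (p^(k-1) * m0))) ≠ 0 := by
      intro h
      apply hh
      ext x
      rw [LinearMap.zero_apply]
      exact hn.1 _ fun y => LinearMap.congr_fun (LinearMap.congr_fun h x) y
    have hBs : (q.compLeft (aeval T (p^(k-1) * m0))).IsSymm := ⟨fun x y => by
      simp only [LinearMap.BilinForm.compLeft_apply, RingHom.id_apply]
      rw [sa_aeval q T hT]; exact hs.eq _ _⟩
    exact LinearMap.BilinForm.exists_bilinForm_self_ne_zero hB (LinearMap.isSymm_def.2 fun x y => hBs.eq x y)
  obtain ⟨u, v, huv⟩ : IsCoprime (p^k) m0 := (hpi.coprime_iff_not_dvd.2 hm1).pow_left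
  set x := aeval T (v * m0) x0 with hx
  have hx1 : aeval T (p^k) x = 0 := by
    rw [hx, ← Module.End.mul_apply, ← map_mul, show p^k * (v * m0) = v * m by rw [hm2]; ring, map_mul, hmT]
    simp
  have hx2 : q (aeval T (p^(k-1) * m0) x) x ≠ 0 := by
    rw [hx, ← sa_aeval q T hT, ← Module.End.mul_apply, ← Module.End.mul_apply, ← map_mul, ← map_mul]
    have : v * m0 * (p^(k-1) * m0) * (v * m0) = p^(k-1)*m0 + (p^(k-1) * u * (-2 + u * p^k)) * m := by
      have h3 : v * m0 = 1 - u * p^k := by rw [← huv]; ring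
      rw [h3, hm2]; ring
    rw [this, map_add, map_mul _ _ m, hmT, mul_zero, add_zero]
    exact hx0
  let c : PK K := ⟨(p, k), hpm, hpi, hk⟩
  have hmon : (p^k).Monic := hpm.pow k
  let Fx : K[X] →ₗ[K] V := (LinearMap.applyₗ x) ∘ₗ (aeval T).toLinearMap
  have hFx : ∀ f, Fx f = aeval T f x := fun f => rfl
  let Φ : RR c →ₗ[K] V := Fx ∘ₗ ((AdjoinRoot.modByMonicHom hmon).restrictScalars K)
  have hΦ : ∀ f, Φ (AdjoinRoot.mk (p^k) f) = aeval T f x := by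
    intro f
    change aeval T (AdjoinRoot.modByMonicHom hmon (AdjoinRoot.mk (p^k) f)) x = _
    rw [AdjoinRoot.modByMonicHom_mk]
    conv_rhs => rw [← modByMonic_add_div f (p^k), mul_comm]
    simp only [map_add, map_mul, LinearMap.add_apply, Module.End.mul_apply]
    rw [hx1]; simp
  let s : RR c →ₗ[K] K := (q.flip x) ∘ₗ Φ
  have hs' : ∀ a, s a = q (Φ a) x := fun a => rfl
  refine ⟨c, Φ, s, ?_, ?_, ?_⟩
  · intro f
    obtain ⟨f, rfl⟩ := AdjoinRoot.mk_surjective f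
    change Φ (AdjoinRoot.mk (p^k) X * AdjoinRoot.mk (p^k) f) = T (Φ (AdjoinRoot.mk (p^k) f))
    rw [← map_mul, hΦ, hΦ, map_mul, aeval_X, Module.End.mul_apply]
  · intro f g
    obtain ⟨f, rfl⟩ := AdjoinRoot.mk_surjective f
    obtain ⟨g, rfl⟩ := AdjoinRoot.mk_surjective g
    rw [← map_mul, hs']
    change q (Φ (AdjoinRoot.mk (p^k) f)) (Φ (AdjoinRoot.mk (p^k) g)) = q (Φ (AdjoinRoot.mk (p^k) (f * g))) x
    rw [hΦ, hΦ, hΦ, mul_comm, map_mul, Module.End.mul_apply, ← sa_aeval q T hT]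
  · intro a ha
    obtain ⟨y, hy⟩ := soc_ex p k hpi a ha
    refine ⟨y * AdjoinRoot.mk _ m0, ?_⟩
    rw [← mul_assoc]
    have : s (a * y * AdjoinRoot.mk (p^k) m0) = q (aeval T (p^(k-1) * m0) x) x := by
      rw [hs', ← hΦ, map_mul (AdjoinRoot.mk (p^k)), map_pow]; rw [← hy]
    exact this ▸ hx2


theorem cyc_decomp [CharZero K] : ∀ (n : ℕ) {V : Type v} [AddCommGroup V] [Module K V] [FiniteDimensional K V],
    finrank K V ≤ n → ∀ (q : LinearMap.BilinForm K V), q.IsSymm → q.Nondegenerate → ∀ (T : Module.End K V),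
    (∀ x y, q (T x) y = q x (T y)) →
    ∃ (I : Type) (_ : Fintype I) (cl : I → PK K) (s : ∀ i, RR (cl i) →ₗ[K] K) (e : V ≃ₗ[K] ∀ i, RR (cl i)),
      (∀ x i, e (T x) i = AdjoinRoot.root _ * e x i) ∧ ∀ x y, q x y = ∑ i, s i (e x i * e y i) := by
  intro n
  induction n with
  | zero =>
    intro V _ _ _ hV q _ _ T _
    haveI : Subsingleton V := (finrank_zero_iff (R := K)).1 (by omega)
    refine ⟨Empty, inferInstance, Empty.elim, fun i => i.elim, LinearEquiv.ofSubsingleton _ _, fun x i => i.elim, fun x y => ?_⟩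
    rw [Subsingleton.elim x 0]; simp
  | succ n ih =>
    intro V _ _ _ hV q hs hn T hT
    rcases subsingleton_or_nontrivial V with hV0 | hV0
    · refine ⟨Empty, inferInstance, Empty.elim, fun i => i.elim, LinearEquiv.ofSubsingleton _ _, fun x i => i.elim, fun x y => ?_⟩
      rw [Subsingleton.elim x 0]; simp
    obtain ⟨c, Φ, s, hΦ, hq, hsn⟩ := cyc_step q hs hn T hT
    have hinj : Function.Injective Φ := by
      rw [← LinearMap.ker_eq_bot, LinearMap.ker_eq_bot']
      intro a ha
      by_contra h
      obtain ⟨y, hy⟩ := hsn a h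
      exact hy (by rw [← hq, ha]; simp)
    set C := LinearMap.range Φ with hC
    have hrefl : q.IsRefl := hs.isRefl
    have hCn : (q.restrict C).Nondegenerate := by
      have hl : ∀ x : C, (∀ y : C, q x y = 0) → x = 0 := by
        rintro ⟨_, a, rfl⟩ h
        by_contra h0
        obtain ⟨y, hy⟩ := hsn a (by rintro rfl; apply h0; ext; simp)
        exact hy (by rw [← hq]; exact h ⟨_, y, rfl⟩)
      exact ⟨fun x h => hl x h, fun x h => hl x fun y => by rw [← hs.eq]; exact h y⟩
    have hcompl := LinearMap.BilinForm.isCompl_orthogonal_of_restrict_nondegenerate hrefl hCn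
    set D := q.orthogonal C with hD
    have hDn : (q.restrict D).Nondegenerate := by
      rw [LinearMap.BilinForm.restrict_nondegenerate_iff_isCompl_orthogonal hrefl,
        LinearMap.BilinForm.orthogonal_orthogonal hn hrefl]
      exact hcompl.symm
    have hCD : ∀ a, ∀ d ∈ D, q (Φ a) d = 0 := fun a d hd => hd (Φ a) ⟨a, rfl⟩
    have hDC : ∀ a, ∀ d ∈ D, q d (Φ a) = 0 := fun a d hd => by
      rw [← hCD a d hd]; exact (hs.eq _ _).symm
    have hTD : ∀ x ∈ D, T x ∈ D := by
      rintro x hx _ ⟨a, rfl⟩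
      change q (Φ a) (T x) = 0
      rw [← hT, ← hΦ]
      exact hCD _ x hx
    have hdim : finrank K D ≤ n := by
      have h1 := Submodule.finrank_add_eq_of_isCompl hcompl
      have h2 : finrank K C = finrank K (RR c) := LinearMap.finrank_range_of_inj hinj
      have h3 : finrank K (RR c) = c.1.2 * c.1.1.natDegree := finrank_RR c.1.1 c.1.2 c.2.2.1 c.2.1
      have h4 : 0 < c.1.2 * c.1.1.natDegree := Nat.mul_pos c.2.2.2 c.2.2.1.natDegree_pos
      omega
    obtain ⟨I, fI, cl, s1, e1, he1, hq1⟩ := ih hdim (q.restrict D) ⟨fun x y => hs.eq _ _⟩ hDn (T.restrict hTD) (fun x y => hT _ _)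
    let cl' : Option I → PK K := fun o => Option.rec c cl o
    let s' : ∀ o, RR (cl' o) →ₗ[K] K := fun o => match o with
      | none => s
      | some i => s1 i
    let e : (∀ o, RR (cl' o)) ≃ₗ[K] V := (LinearEquiv.piOptionEquivProd K (M := fun o => RR (cl' o))) ≪≫ₗ
      (LinearEquiv.prodCongr (LinearEquiv.ofInjective Φ hinj) e1.symm) ≪≫ₗ Submodule.prodEquivOfIsCompl C D hcompl
    have he : ∀ z, e z = Φ (z none) + (e1.symm fun i => z (some i) : D) := fun z => rfl
    refine ⟨Option I, inferInstance, cl', s', e.symm, ?_, ?_⟩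
    · intro x o
      obtain ⟨z, rfl⟩ := e.surjective x
      rw [e.symm_apply_apply]
      have : T (e z) = e (fun o => AdjoinRoot.root _ * z o) := by
        rw [he, he, map_add]
        congr 1
        · exact (hΦ _).symm
        · have : T.restrict hTD (e1.symm fun i => z (some i)) = e1.symm fun i => AdjoinRoot.root _ * z (some i) := by
            rw [LinearEquiv.eq_symm_apply]
            ext i
            rw [he1, e1.apply_symm_apply]
          rw [← this]; rfl
      rw [this, e.symm_apply_apply]
    · intro x y
      obtain ⟨z, rfl⟩ := e.surjective x
      obtain ⟨w, rfl⟩ := e.surjective y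
      rw [e.symm_apply_apply, e.symm_apply_apply, Fintype.sum_option, he, he]
      simp only [map_add, LinearMap.add_apply]
      rw [hq, hCD _ _ (Subtype.mem _), hDC _ _ (Subtype.mem _), add_zero, zero_add]
      congr 1
      have := hq1 (e1.symm fun i => z (some i)) (e1.symm fun i => w (some i))
      rw [e1.apply_symm_apply, e1.apply_symm_apply] at this
      exact this
end D1

open Module TensorProduct
section D2
open Polynomial
universe u v
variable {K : Type u} [Field K] {V : Type v} [AddCommGroup V] [Module K V]

lemma regroup {I : Type} [Fintype I] {P : Type u} (cl : I → P) (F : P → Type u) [∀ c, AddCommGroup (F c)] [∀ c, Module K (F c)] :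
    ∃ G : (∀ c : Set.range cl, {i // Set.rangeFactorization cl i = c} → F c.1) ≃ₗ[K] ∀ i, F (cl i),
      ∀ g i, G g i = g (Set.rangeFactorization cl i) ⟨i, rfl⟩ := by
  let G : (∀ c : Set.range cl, {i // Set.rangeFactorization cl i = c} → F c.1) →ₗ[K] ∀ i, F (cl i) :=
    { toFun := fun g i => g (Set.rangeFactorization cl i) ⟨i, rfl⟩
      map_add' := fun _ _ => rfl
      map_smul' := fun _ _ => rfl }
  have hG : Function.Bijective G := by
    constructor
    · intro g g' h
      ext c i
      obtain ⟨i, rfl⟩ := i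
      exact congrFun h i
    · intro f
      refine ⟨fun c i => (show F (Set.rangeFactorization cl i).1 = F c.1 by rw [i.2]) ▸ f i, ?_⟩
      ext i
      rfl
  exact ⟨LinearEquiv.ofBijective G hG, fun g i => rfl⟩

theorem nform [CharZero K] [FiniteDimensional K V] (q : LinearMap.BilinForm K V) (hs : q.IsSymm) (hn : q.Nondegenerate)
    (T : Module.End K V) (hT : ∀ x y, q (T x) y = q x (T y)) :
    ∃ (C : Type u) (_ : Fintype C) (κ : C → PK K) (_ : Function.Injective κ) (I : C → Type) (_ : ∀ c, Fintype (I c))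
      (w : ∀ c, I c → LL (κ c)) (s0 : ∀ c, RR (κ c) →ₗ[K] K) (ι : ∀ c, LL (κ c) →ₐ[K] RR (κ c))
      (e : V ≃ₗ[K] ∀ c, I c → RR (κ c)),
      (∀ c i, w c i ≠ 0) ∧ (∀ x c i, e (T x) c i = AdjoinRoot.root _ * e x c i) ∧
      (∀ x y, q x y = ∑ c, ∑ i, s0 c (ι c (w c i) * (e x c i * e y c i))) ∧
      ∀ c (O : FieldOrdering K) (j : ℕ) (g : K[X]) (a : LL (κ c)), ¬ (κ c).1.1 ∣ g → a ≠ 0 →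
        signatureAt O (fun x => sB (s0 c) (ι c a * AdjoinRoot.mk _ ((κ c).1.1^j * g)) x x) =
          if j < (κ c).1.2 ∧ Odd ((κ c).1.2 - j) then signatureAt O (fun x => trB K (AdjoinRoot.mk (κ c).1.1 g * a) x x) else 0 := by
  obtain ⟨I, fI, cl, s, e, heT, hq⟩ := cyc_decomp _ le_rfl q hs hn T hT
  choose s0 ι h1 h2 using fun c : PK K => local_nf c.1.1 c.1.2 c.2.1 c.2.2.2
  classical
  have hsn : ∀ i, ∀ x, x ≠ 0 → ∃ y, s i (x * y) ≠ 0 := by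
    intro i x hx
    by_contra! h
    have : e.symm (Pi.single i x) = 0 := by
      apply hn.1
      intro y
      rw [hq, e.apply_symm_apply]
      apply Finset.sum_eq_zero
      intro j _
      by_cases hj : j = i
      · subst hj; rw [Pi.single_eq_same]; exact h _
      · rw [Pi.single_eq_of_ne hj, zero_mul, map_zero]
    rw [LinearEquiv.symm_apply_eq, map_zero] at this
    exact hx (by simpa using congrFun this i)
  choose w v hw hv hsv using fun i => h1 (cl i) (s i) (hsn i)
  obtain ⟨G, hG⟩ := regroup (K := K) cl (fun c => RR c)
  let e2 : (∀ i, RR (cl i)) ≃ₗ[K] ∀ i, RR (cl i) := LinearEquiv.piCongrRight fun i =>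
    LinearEquiv.ofBijective (LinearMap.mulLeft K (v i)) (by
      have := (hv i)
      exact ⟨fun a b h => this.mul_left_cancel h, fun b => by
        obtain ⟨r, hr⟩ := this.exists_right_inv
        exact ⟨r * b, by rw [LinearMap.mulLeft_apply, ← mul_assoc, hr, one_mul]⟩⟩)
  have he2 : ∀ f i, e2 f i = v i * f i := fun f i => rfl
  have hGs : ∀ f i, G.symm f (Set.rangeFactorization cl i) ⟨i, rfl⟩ = f i := fun f i =>
    (hG (G.symm f) i).symm.trans (congrFun (G.apply_symm_apply f) i)
  refine ⟨Set.range cl, Fintype.ofFinite _, Subtype.val, Subtype.val_injective,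
    fun c => {i // Set.rangeFactorization cl i = c}, fun c => inferInstance,
    fun c i => (show LL (Set.rangeFactorization cl i).1 = LL c.1 by rw [i.2]) ▸ w i, fun c => s0 c, fun c => ι c, e ≪≫ₗ e2 ≪≫ₗ G.symm, ?_, ?_, ?_, ?_⟩
  · rintro c ⟨i, rfl⟩
    exact hw i
  · rintro x c ⟨i, rfl⟩
    simp only [LinearEquiv.trans_apply]
    rw [hGs, hGs, he2, he2, heT]
    exact mul_left_comm _ _ _
  · intro x y
    letI : Fintype (Set.range cl) := Fintype.ofFinite _
    rw [hq, ← (Equiv.sigmaFiberEquiv (Set.rangeFactorization cl)).sum_comp, Fintype.sum_sigma]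
    refine Finset.sum_congr rfl fun c _ => Finset.sum_congr rfl ?_
    rintro ⟨i, rfl⟩ _
    simp only [LinearEquiv.trans_apply]
    rw [hGs, hGs, he2, he2]
    change s i (e x i * e y i) = s0 (cl i) (ι (cl i) (w i) * ((v i * e x i) * (v i * e y i)))
    rw [hsv]
    congr 1
    ring
  · intro c
    exact h2 c
end D2

open Module TensorProduct
section S1
open Polynomial
universe u v
variable {K : Type u} [Field K] {V : Type v} [AddCommGroup V] [Module K V] [FiniteDimensional K V]
  {C : Type u} [Fintype C] {κ : C → PK K} {I : C → Type} [∀ c, Fintype (I c)]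

lemma e_aeval (T : Module.End K V) (e : V ≃ₗ[K] ∀ c, I c → RR (κ c))
    (heT : ∀ x c i, e (T x) c i = AdjoinRoot.root _ * e x c i) (F : K[X]) (x : V) (c i) :
    e (aeval T F x) c i = AdjoinRoot.mk _ F * e x c i := by
  induction F using Polynomial.induction_on' with
  | add f g hf hg => simp only [map_add, LinearMap.add_apply, Pi.add_apply, hf, hg]; rw [add_mul]
  | monomial n a =>
    rw [← C_mul_X_pow_eq_monomial, map_mul, map_mul, aeval_C, map_pow, map_pow, aeval_X, AdjoinRoot.mk_X, AdjoinRoot.mk_C,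
      Module.End.mul_apply, Module.algebraMap_end_apply, map_smul]
    have : ∀ n, e ((T^n) x) c i = AdjoinRoot.root _ ^ n * e x c i := by
      intro n
      induction n with
      | zero => simp
      | succ n ih => rw [pow_succ', Module.End.mul_apply, heT, ih, pow_succ']; ring
    rw [Pi.smul_apply, Pi.smul_apply, this, mul_assoc, Algebra.smul_def]; rfl

lemma sig_split (q : LinearMap.BilinForm K V) (T : Module.End K V)
    (w : ∀ c, I c → LL (κ c)) (s0 : ∀ c, RR (κ c) →ₗ[K] K) (ι : ∀ c, LL (κ c) →ₐ[K] RR (κ c))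
    (e : V ≃ₗ[K] ∀ c, I c → RR (κ c))
    (heT : ∀ x c i, e (T x) c i = AdjoinRoot.root _ * e x c i)
    (hq : ∀ x y, q x y = ∑ c, ∑ i, s0 c (ι c (w c i) * (e x c i * e y c i))) (O : FieldOrdering K) (F : K[X]) :
    signatureAt O (fun x => q (aeval T F x) x) =
      ∑ c, ∑ i, signatureAt O (fun x => sB (s0 c) (ι c (w c i) * AdjoinRoot.mk _ F) x x) := by
  have h1 := signatureAt_eq O (q.compLeft (aeval T F)).toQuadraticMap
  have h2 : ∀ c i, _ := fun c i => signatureAt_eq O (sB (s0 c) (ι c (w c i) * AdjoinRoot.mk _ F)).toQuadraticMap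
  simp only [LinearMap.BilinMap.toQuadraticMap_apply, LinearMap.BilinForm.compLeft_apply] at h1 h2
  simp only [h1, h2]
  letI := O.lo
  haveI := O.so
  have hfin : ∀ c, Module.Finite K (I c → RR (κ c)) := fun c => inferInstance
  let Qc : ∀ c, QuadraticForm K (I c → RR (κ c)) := fun c =>
    ∑ i, (sB (s0 c) (ι c (w c i) * AdjoinRoot.mk _ F)).toQuadraticMap.comp (LinearMap.proj i)
  let Q : QuadraticForm K (∀ c, I c → RR (κ c)) := ∑ c, (Qc c).comp (LinearMap.proj c)
  have hQc : ∀ c x, Qc c x = ∑ i, (sB (s0 c) (ι c (w c i) * AdjoinRoot.mk _ F)).toQuadraticMap (x i) := by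
    intro c x; simp [Qc, QuadraticMap.sum_apply]
  have hQ : ∀ x, Q x = ∑ c, Qc c (x c) := by
    intro x; simp [Q, QuadraticMap.sum_apply]
  have e1 : sg (q.compLeft (aeval T F)).toQuadraticMap = sg Q := by
    apply sg_equiv _ _ e
    intro x
    rw [hQ]
    simp only [hQc, LinearMap.BilinMap.toQuadraticMap_apply, LinearMap.BilinForm.compLeft_apply, sB_apply]
    rw [hq]
    refine Finset.sum_congr rfl fun c _ => Finset.sum_congr rfl fun i _ => ?_
    rw [e_aeval T e heT]
    congr 1
    ring
  change sg _ = _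
  rw [e1, sg_pi Q Qc hQ]
  exact Finset.sum_congr rfl fun c _ => sg_pi _ _ (hQc c)

theorem sig_extract (hκ : Function.Injective κ) (q : LinearMap.BilinForm K V) (T : Module.End K V)
    (w : ∀ c, I c → LL (κ c)) (s0 : ∀ c, RR (κ c) →ₗ[K] K) (ι : ∀ c, LL (κ c) →ₐ[K] RR (κ c))
    (e : V ≃ₗ[K] ∀ c, I c → RR (κ c)) (hw : ∀ c i, w c i ≠ 0)
    (heT : ∀ x c i, e (T x) c i = AdjoinRoot.root _ * e x c i)
    (hq : ∀ x y, q x y = ∑ c, ∑ i, s0 c (ι c (w c i) * (e x c i * e y c i)))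
    (hsig : ∀ c (O : FieldOrdering K) (j : ℕ) (g : K[X]) (a : LL (κ c)), ¬ (κ c).1.1 ∣ g → a ≠ 0 →
        signatureAt O (fun x => sB (s0 c) (ι c a * AdjoinRoot.mk _ ((κ c).1.1^j * g)) x x) =
          if j < (κ c).1.2 ∧ Odd ((κ c).1.2 - j) then signatureAt O (fun x => trB K (AdjoinRoot.mk (κ c).1.1 g * a) x x) else 0)
    (O : FieldOrdering K)
    (h0 : ∀ F : K[X], signatureAt O (fun x => q (aeval T F x) x) = 0) (c0 : C) (g : LL (κ c0)) (hg : g ≠ 0) :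
    ∑ i, signatureAt O (fun x => trB K (g * w c0 i) x x) = 0 := by
  classical
  obtain ⟨g, rfl⟩ := AdjoinRoot.mk_surjective g
  rw [Ne, AdjoinRoot.mk_eq_zero] at hg
  obtain ⟨p, hp⟩ : ∃ p, p = (κ c0).1.1 := ⟨_, rfl⟩
  have hpi : Irreducible p := hp ▸ (κ c0).2.2.1
  let E : K[X] := ∏ c with (κ c).1.1 ≠ p, (κ c).1.1 ^ (κ c).1.2
  have hE : IsCoprime p E := by
    apply IsCoprime.prod_right
    intro c hc
    apply IsCoprime.pow_right
    rw [hpi.coprime_iff_not_dvd]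
    intro hd
    rw [Finset.mem_filter] at hc
    apply hc.2
    exact (Polynomial.eq_of_monic_of_associated (hp ▸ (κ c0).2.1) (κ c).2.1 (hpi.associated_of_dvd (κ c).2.2.1 hd)).symm
  obtain ⟨a, b, hab⟩ := hE
  set ε := b * E with hε
  have hpε : ¬ p ∣ ε := by
    intro h
    apply hpi.not_isUnit
    apply isUnit_of_dvd_one
    rw [← hab]
    exact dvd_add (dvd_mul_left _ _) h
  let t : C → ℤ := fun c => ∑ i, signatureAt O (fun x => trB K (AdjoinRoot.mk (κ c).1.1 g * w c i) x x)
  have key : ∀ j c, ∑ i, signatureAt O (fun x => sB (s0 c) (ι c (w c i) * AdjoinRoot.mk _ (p^j * (g * ε))) x x) =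
      if (κ c).1.1 = p ∧ j < (κ c).1.2 ∧ Odd ((κ c).1.2 - j) then t c else 0 := by
    intro j c
    by_cases hc : (κ c).1.1 = p
    · have hnd : ¬ (κ c).1.1 ∣ g * ε := by
        rw [hc]
        intro h
        rcases hpi.prime.dvd_or_dvd h with h | h
        · exact hg (hp ▸ h)
        · exact hpε h
      have hmk : AdjoinRoot.mk (κ c).1.1 (g * ε) = AdjoinRoot.mk (κ c).1.1 g := by
        rw [AdjoinRoot.mk_eq_mk, hc]
        have h5 : ε = 1 - a * p := by rw [← hab]; ring
        rw [h5]
        exact ⟨- (g * a), by ring⟩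
      have hpj : p ^ j * (g * ε) = (κ c).1.1 ^ j * (g * ε) := by rw [hc]
      have hif : ((κ c).1.1 = p ∧ j < (κ c).1.2 ∧ Odd ((κ c).1.2 - j)) ↔ (j < (κ c).1.2 ∧ Odd ((κ c).1.2 - j)) :=
        ⟨fun h => h.2, fun h => ⟨hc, h⟩⟩
      rw [hpj, if_congr hif rfl rfl]
      rw [Finset.sum_congr rfl fun i _ => hsig c O j (g * ε) (w c i) hnd (hw c i), hmk]
      split_ifs with h
      · rfl
      · simp
    · rw [if_neg (fun h => hc h.1)]
      apply Finset.sum_eq_zero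
      intro i _
      have h1 := hsig c O (κ c).1.2 1 1 (fun h => (κ c).2.2.1.not_isUnit (isUnit_of_dvd_one h)) one_ne_zero
      rw [if_neg (fun h => lt_irrefl _ h.1), mul_one, AdjoinRoot.mk_self, mul_zero] at h1
      have h2 : AdjoinRoot.mk ((κ c).1.1 ^ (κ c).1.2) (p^j * (g * ε)) = 0 := by
        rw [AdjoinRoot.mk_eq_zero]
        have : (κ c).1.1 ^ (κ c).1.2 ∣ E := Finset.dvd_prod_of_mem (fun c => (κ c).1.1 ^ (κ c).1.2) (by simp [hc])
        exact ((this.mul_left b).mul_left g).mul_left _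
      rw [h2, mul_zero]
      exact h1
  have hS : ∀ j, ∑ c, (if (κ c).1.1 = p ∧ j < (κ c).1.2 ∧ Odd ((κ c).1.2 - j) then t c else 0) = 0 := by
    intro j
    have h5 := h0 (p^j * (g * ε))
    rw [sig_split q T w s0 ι e heT hq] at h5
    exact (Finset.sum_congr rfl fun c _ => (key j c).symm).trans h5
  have h3 := congrArg₂ (· - ·) (hS ((κ c0).1.2 - 1)) (hS ((κ c0).1.2 + 1))
  simp only [← Finset.sum_sub_distrib, sub_zero] at h3
  rw [Finset.sum_eq_single c0] at h3
  · have hk := (κ c0).2.2.2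
    rw [if_pos, if_neg, sub_zero] at h3
    · exact h3
    · omega
    · refine ⟨hp.symm, by omega, ?_⟩
      rw [show (κ c0).1.2 - ((κ c0).1.2 - 1) = 1 by omega]
      exact odd_one
  · intro c _ hc
    by_cases hcp : (κ c).1.1 = p
    · have hne : (κ c).1.2 ≠ (κ c0).1.2 := by
        intro h
        apply hc
        apply hκ
        apply Subtype.ext
        exact Prod.ext (hcp.trans hp) h
      have hk := (κ c0).2.2.2
      have hiff : ((κ c0).1.2 - 1 < (κ c).1.2 ∧ Odd ((κ c).1.2 - ((κ c0).1.2 - 1))) ↔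
        ((κ c0).1.2 + 1 < (κ c).1.2 ∧ Odd ((κ c).1.2 - ((κ c0).1.2 + 1))) := by
        rw [Nat.odd_iff, Nat.odd_iff]
        omega
      simp only [hiff, sub_self]
    · simp [hcp]
  · simp
end S1

open Module TensorProduct
section H1
open Polynomial
universe u v
variable {K : Type u} [Field K] {V : Type v} [AddCommGroup V] [Module K V] [FiniteDimensional K V]
  {C : Type u} [Fintype C] {κ : C → PK K} {I : C → Type} [∀ c, Fintype (I c)]

lemma invol_split [CharZero K] {X : Type*} [AddCommGroup X] [Module K X] (σ : Module.End K X) (hσ : ∀ x, σ (σ x) = x) :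
    IsCompl (LinearMap.ker (σ - 1)) (LinearMap.ker (σ + 1)) := by
  constructor
  · rw [Submodule.disjoint_def]
    intro x h1 h2
    rw [LinearMap.mem_ker, LinearMap.sub_apply, Module.End.one_apply, sub_eq_zero] at h1
    rw [LinearMap.mem_ker, LinearMap.add_apply, Module.End.one_apply, h1, ← two_smul K] at h2
    exact (smul_eq_zero.1 h2).resolve_left two_ne_zero
  · rw [codisjoint_iff, eq_top_iff]
    intro x _
    have : x = (2⁻¹ : K) • (x + σ x) + (2⁻¹ : K) • (x - σ x) := by
      rw [← smul_add, add_add_sub_cancel, ← two_smul K, smul_smul, inv_mul_cancel₀ two_ne_zero, one_smul]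
    rw [this]
    apply Submodule.add_mem_sup
    · apply Submodule.smul_mem
      simp [hσ, add_comm]
    · apply Submodule.smul_mem
      simp [hσ]

theorem hyp_build [CharZero K] (q : LinearMap.BilinForm K V) (T : Module.End K V)
    (w : ∀ c, I c → LL (κ c)) (s0 : ∀ c, RR (κ c) →ₗ[K] K) (ι : ∀ c, LL (κ c) →ₐ[K] RR (κ c))
    (e : V ≃ₗ[K] ∀ c, I c → RR (κ c)) (hw : ∀ c i, w c i ≠ 0)
    (heT : ∀ x c i, e (T x) c i = AdjoinRoot.root _ * e x c i)
    (hq : ∀ x y, q x y = ∑ c, ∑ i, s0 c (ι c (w c i) * (e x c i * e y c i)))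
    (h0 : ∀ c, ∀ O : FieldOrdering (LL (κ c)), ∑ i, osgn O (w c i) = 0) :
    ∃ N : ℕ, 0 < N ∧ ∃ U W : Submodule K (Fin N → V), IsCompl U W ∧
      (∀ x ∈ U, ∑ r, q (x r) (x r) = 0 ∧ ∑ r, q (T (x r)) (x r) = 0) ∧
      (∀ x ∈ W, ∑ r, q (x r) (x r) = 0 ∧ ∑ r, q (T (x r)) (x r) = 0) := by
  classical
  choose n hn using fun c => pfister (fun i => Units.mk0 (w c i) (hw c i)) (h0 c)
  let m := Finset.univ.sup n
  have hm : ∀ c, n c ≤ m := fun c => Finset.le_sup (Finset.mem_univ c)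
  choose S hS hSs using fun c => met_skew _ (hn c m (hm c))
  simp only [Units.val_mk0] at hSs
  let N := 2 ^ m
  let σ : Module.End K (Fin N → V) :=
    { toFun := fun x r => e.symm (fun c i => ∑ z : Fin N × I c, ι c (S c (r, i) z) * e (x z.1) c z.2)
      map_add' := by
        intro x y
        ext r
        rw [Pi.add_apply, ← map_add]
        congr 1
        ext c i
        simp only [Pi.add_apply, map_add, mul_add, Finset.sum_add_distrib]
      map_smul' := by
        intro a x
        ext r
        rw [RingHom.id_apply, Pi.smul_apply, ← map_smul]
        congr 1
        ext c i
        simp only [Pi.smul_apply, map_smul, mul_smul_comm, Finset.smul_sum] }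
  have hσe : ∀ x r c i, e (σ x r) c i = ∑ z : Fin N × I c, ι c (S c (r, i) z) * e (x z.1) c z.2 := by
    intro x r c i
    change e (e.symm _) c i = _
    rw [e.apply_symm_apply]
  have hσ2 : ∀ x, σ (σ x) = x := by
    intro x
    ext r
    apply e.injective
    ext c i
    rw [hσe]
    simp only [hσe, Finset.mul_sum]
    rw [Finset.sum_comm]
    have : ∀ z' : Fin N × I c, ∑ z : Fin N × I c, ι c (S c (r, i) z) * (ι c (S c (z.1, z.2) z') * e (x z'.1) c z'.2) =
        if (r, i) = z' then e (x z'.1) c z'.2 else 0 := by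
      intro z'
      have h1 : ∑ z : Fin N × I c, S c (r, i) z * S c z z' = (1 : Matrix _ _ (LL (κ c))) (r, i) z' := by
        rw [← hS c, Matrix.mul_apply]
      simp only [← mul_assoc, ← map_mul, Prod.mk.eta]
      rw [← Finset.sum_mul, ← map_sum, h1, Matrix.one_apply]
      split_ifs <;> simp
    rw [Finset.sum_congr rfl fun z _ => this z, Finset.sum_ite_eq]
    simp
  let TN : (Fin N → V) → (Fin N → V) := fun x r => T (x r)
  have hσT : ∀ x, σ (TN x) = TN (σ x) := by
    intro x
    ext r
    apply e.injective
    ext c i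
    rw [hσe]
    simp only [TN, heT, hσe, Finset.mul_sum]
    exact Finset.sum_congr rfl fun z _ => mul_left_comm _ _ _
  let b : (Fin N → V) → (Fin N → V) → K := fun x y => ∑ r, q (x r) (y r)
  have hb : ∀ x y, b x y = ∑ c, ∑ z : Fin N × I c, s0 c (ι c (w c z.2) * (e (x z.1) c z.2 * e (y z.1) c z.2)) := by
    intro x y
    simp only [b, hq]
    rw [Finset.sum_comm]
    refine Finset.sum_congr rfl fun c _ => ?_
    rw [Fintype.sum_prod_type]
  have hskew : ∀ x y, b (σ x) y = - b x (σ y) := by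
    intro x y
    rw [hb, hb, ← Finset.sum_neg_distrib]
    refine Finset.sum_congr rfl fun c _ => ?_
    simp only [hσe, Finset.mul_sum, Finset.sum_mul, map_sum, ← Finset.sum_neg_distrib, Prod.mk.eta]
    rw [Finset.sum_comm]
    refine Finset.sum_congr rfl fun z _ => Finset.sum_congr rfl fun z' _ => ?_
    rw [← map_neg]
    congr 1
    have h1 : ι c (w c z'.2) * ι c (S c z' z) = - (ι c (w c z.2) * ι c (S c z z')) := by
      rw [← map_mul, ← map_mul, ← map_neg]
      exact congrArg _ (hSs c z' z)
    calc _ = (ι c (w c z'.2) * ι c (S c z' z)) * (e (x z.1) c z.2 * e (y z'.1) c z'.2) := by ring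
      _ = _ := by rw [h1]; ring
  have hneg : ∀ x y, b x (-y) = - b x y := by
    intro x y; simp [b]
  have hneg2 : ∀ x y, b (-x) y = - b x y := by
    intro x y; simp [b]
  have hTneg : ∀ x, TN (-x) = - TN x := by
    intro x; ext r; simp [TN]
  have hz : ∀ a : K, a = -a → a = 0 := fun a h => self_eq_neg.1 h
  refine ⟨N, by positivity, _, _, invol_split σ hσ2, ?_, ?_⟩
  · intro x hx
    rw [LinearMap.mem_ker, LinearMap.sub_apply, Module.End.one_apply, sub_eq_zero] at hx
    constructor
    · change b x x = 0
      apply hz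
      have := hskew x x
      rwa [hx] at this
    · change b (TN x) x = 0
      apply hz
      have := hskew (TN x) x
      rwa [hσT, hx] at this
  · intro x hx
    rw [LinearMap.mem_ker, LinearMap.add_apply, Module.End.one_apply, add_eq_zero_iff_eq_neg] at hx
    constructor
    · change b x x = 0
      apply hz
      have := hskew x x
      rw [hx, hneg, hneg2, neg_neg] at this
      exact this.symm
    · change b (TN x) x = 0
      apply hz
      have := hskew (TN x) x
      rw [hσT, hx, hTneg, hneg, hneg2, neg_neg] at this
      exact this.symm
end H1

open Module TensorProduct
section AB
universe u v
variable {K : Type u} [Field K]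

lemma sg_met [LinearOrder K] [IsStrictOrderedRing K] {X : Type*} [AddCommGroup X] [Module K X] [FiniteDimensional K X]
    (B : LinearMap.BilinForm K X) (hB : B.IsSymm) (U W : Submodule K X) (h : IsCompl U W)
    (hU : ∀ x ∈ U, ∀ y ∈ U, B x y = 0) (hW : ∀ x ∈ W, ∀ y ∈ W, B x y = 0) : sg B.toQuadraticMap = 0 := by
  set R := B.toQuadraticMap.radical with hR
  have hiso : ∀ U : Submodule K X, (∀ x ∈ U, ∀ y ∈ U, B x y = 0) → ∀ x ∈ U ⊔ R, B x x = 0 := by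
    intro U hU x hx
    obtain ⟨a, ha, b, hb, rfl⟩ := Submodule.mem_sup.1 hx
    rw [hR, mem_rad B hB] at hb
    have : B a b = 0 := by rw [← hb a]; exact (hB.eq _ _).symm
    simp [hU a ha a ha, hb, this]
  have hdim := Submodule.finrank_sup_add_finrank_inf_eq (U ⊔ R) (W ⊔ R)
  have h1 : (U ⊔ R) ⊔ (W ⊔ R) = ⊤ := by
    rw [eq_top_iff, ← h.sup_eq_top]
    exact sup_le_sup le_sup_left le_sup_left
  have h2 : R ≤ (U ⊔ R) ⊓ (W ⊔ R) := le_inf le_sup_right le_sup_right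
  have h3 := Submodule.finrank_mono h2
  rw [h1, finrank_top] at hdim
  have fin : ∀ Y : Submodule K X, (∀ x ∈ Y, B x x = 0) → finrank K X + finrank K R ≤ 2 * finrank K Y → sg B.toQuadraticMap = 0 := by
    intro Y hY hd
    rw [← sg_sub (0 : QuadraticForm K PUnit)]
    apply sg_red _ _ Y.subtype 0
    · intro x
      simpa using hY x x.2
    · rw [finrank_zero_of_subsingleton, Submodule.range_subtype, zero_add]
      exact hd
  by_cases hc : finrank K X + finrank K R ≤ 2 * finrank K (U ⊔ R : Submodule K X)
  · exact fin _ (hiso U hU) hc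
  · exact fin _ (hiso W hW) (by omega)

variable {V : Type v} [AddCommGroup V] [Module K V] [FiniteDimensional K V]

/-- the bilinear form on the power -/
noncomputable def nB (n : ℕ) (q : LinearMap.BilinForm K V) : LinearMap.BilinForm K (Fin n → V) :=
  ∑ r, q.comp (LinearMap.proj r) (LinearMap.proj r)

lemma nB_apply (n : ℕ) (q : LinearMap.BilinForm K V) (x y : Fin n → V) : nB n q x y = ∑ r, q (x r) (y r) := by
  simp [nB, LinearMap.sum_apply]

lemma nB_symm (n : ℕ) (q : LinearMap.BilinForm K V) (hq : q.IsSymm) : (nB n q).IsSymm := ⟨fun x y => by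
  simp only [nB_apply, RingHom.id_apply]
  exact Finset.sum_congr rfl fun r _ => hq.eq _ _⟩

lemma nB_single_left (n : ℕ) (q : LinearMap.BilinForm K V) (x : V) (r) (y : Fin n → V) :
    nB n q (Pi.single r x) y = q x (y r) := by
  rw [nB_apply, Finset.sum_eq_single r]
  · simp
  · intro s _ hs; simp [hs]
  · simp

lemma nB_single_right (n : ℕ) (q : LinearMap.BilinForm K V) (x : V) (r) (y : Fin n → V) :
    nB n q y (Pi.single r x) = q (y r) x := by
  rw [nB_apply, Finset.sum_eq_single r]
  · simp
  · intro s _ hs; simp [hs]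
  · simp

lemma nB_ext (n : ℕ) (q : LinearMap.BilinForm K V) (ψ φ : Module.End K (Fin n → V))
    (h : ∀ r s x y, nB n q (ψ (Pi.single s x)) (Pi.single r y) = nB n q (Pi.single s x) (φ (Pi.single r y))) (x y) :
    nB n q (ψ x) y = nB n q x (φ y) := by
  have hx := (Finset.univ_sum_single x).symm
  have hy := (Finset.univ_sum_single y).symm
  rw [hx, hy]
  simp only [map_sum, LinearMap.sum_apply, h]

lemma isotropic_bilin [NeZero (2 : K)] {X : Type*} [AddCommGroup X] [Module K X] (B : LinearMap.BilinForm K X) (hB : B.IsSymm)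
    (U : Submodule K X) (h : ∀ x ∈ U, B x x = 0) : ∀ x ∈ U, ∀ y ∈ U, B x y = 0 := by
  intro x hx y hy
  have h1 := h (x + y) (U.add_mem hx hy)
  have h2 : B y x = B x y := hB.eq y x
  simp only [map_add, LinearMap.add_apply, h x hx, h y hy, h2, zero_add, add_zero, ← two_mul] at h1
  exact (mul_eq_zero.1 h1).resolve_left two_ne_zero

theorem a_to_b (q₁ q₂ : LinearMap.BilinForm K V) (h₁ : q₁.IsSymm) (h₂ : q₂.IsSymm) (n : ℕ) (hn : 0 < n)
    (hyp : IsHyperbolicSystem fun i : Fin 2 => timesQ n fun v => ![q₁, q₂] i v v)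
    (W : LinearMap.BilinForm K V) (hW : W.IsSymm)
    (hcl : ∀ φ ψ : Module.End K V,
          (∀ x y : V, q₁ (ψ x) y = q₁ x (φ y)) →
          (∀ x y : V, q₂ (ψ x) y = q₂ x (φ y)) →
          ∀ x y : V, W (ψ x) y = W x (φ y)) (O : FieldOrdering K) : signatureAt O (fun v => W v v) = 0 := by
  have h := signatureAt_eq O W.toQuadraticMap
  simp only [LinearMap.BilinMap.toQuadraticMap_apply] at h
  rw [h]
  letI := O.lo
  haveI := O.so
  change sg _ = 0
  obtain ⟨U, D, hc, hU, hD⟩ := hyp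
  have key : ∀ i : Fin 2, (![q₁, q₂] i).IsSymm := by
    intro i; fin_cases i
    · exact h₁
    · exact h₂
  have hU' : ∀ i : Fin 2, ∀ x ∈ U, ∀ y ∈ U, nB n (![q₁, q₂] i) x y = 0 := fun i =>
    isotropic_bilin _ (nB_symm _ _ (key i)) U fun x hx => by rw [nB_apply]; exact hU i x hx
  have hD' : ∀ i : Fin 2, ∀ x ∈ D, ∀ y ∈ D, nB n (![q₁, q₂] i) x y = 0 := fun i =>
    isotropic_bilin _ (nB_symm _ _ (key i)) D fun x hx => by rw [nB_apply]; exact hD i x hx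
  let P : Module.End K (Fin n → V) := U.subtype ∘ₗ Submodule.projectionOnto U D hc
  have hPU : ∀ x, P x ∈ U := fun x => Subtype.mem _
  have hP1 : ∀ x ∈ U, P x = x := fun x hx => by
    change ((Submodule.projectionOnto U D hc x : U) : Fin n → V) = x
    rw [Submodule.linearProjOfIsCompl_apply_left hc ⟨x, hx⟩]
  have hP0 : ∀ x ∈ D, P x = 0 := fun x hx => by
    change ((Submodule.projectionOnto U D hc x : U) : Fin n → V) = 0
    rw [(Submodule.linearProjOfIsCompl_apply_eq_zero_iff hc).2 hx]; rfl
  have hPD : ∀ x, x - P x ∈ D := fun x => by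
    rw [← Submodule.linearProjOfIsCompl_apply_eq_zero_iff hc]
    ext1
    change P (x - P x) = 0
    rw [map_sub, hP1 _ (hPU x), sub_self]
  have hadj : ∀ i : Fin 2, ∀ x y, nB n (![q₁, q₂] i) (P x) y = nB n (![q₁, q₂] i) x (y - P y) := by
    intro i x y
    have e1 : nB n (![q₁, q₂] i) (P x) y = nB n (![q₁, q₂] i) (P x) (y - P y) := by
      rw [map_sub, hU' i _ (hPU x) _ (hPU y), sub_zero]
    have e2 : nB n (![q₁, q₂] i) (x - P x) (y - P y) = 0 := hD' i _ (hPD x) _ (hPD y)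
    rw [map_sub (nB n (![q₁, q₂] i)), LinearMap.sub_apply, sub_eq_zero] at e2
    rw [e1, e2]
  have hWadj : ∀ x y, nB n W (P x) y = nB n W x ((1 - P) y) := by
    apply nB_ext
    intro r s x y
    rw [nB_single_left, nB_single_right]
    have h3 := hcl (LinearMap.proj s ∘ₗ (1 - P) ∘ₗ LinearMap.single K (fun _ => V) r) (LinearMap.proj r ∘ₗ P ∘ₗ LinearMap.single K (fun _ => V) s)
      (fun x y => by
        have := hadj 0 (Pi.single s x) (Pi.single r y)
        rw [nB_single_left, nB_single_right] at this
        exact this)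
      (fun x y => by
        have := hadj 1 (Pi.single s x) (Pi.single r y)
        rw [nB_single_left, nB_single_right] at this
        exact this)
    exact h3 x y
  have hsg : sg (nB n W).toQuadraticMap = 0 := by
    apply sg_met _ (nB_symm n W hW) U D hc
    · intro x hx y hy
      have := hWadj x y
      rw [hP1 x hx, LinearMap.sub_apply, Module.End.one_apply, hP1 y hy, sub_self, map_zero] at this
      exact this
    · intro x hx y hy
      have := hWadj x y
      rw [hP0 x hx, LinearMap.sub_apply, Module.End.one_apply, hP0 y hy, sub_zero, map_zero] at this
      exact this.symm
  rw [sg_pi (nB n W).toQuadraticMap (fun _ => W.toQuadraticMap) (fun x => by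
    simp [LinearMap.BilinMap.toQuadraticMap_apply, nB_apply])] at hsg
  simp only [Finset.sum_const, Finset.card_univ, Fintype.card_fin, nsmul_eq_mul, mul_eq_zero, Nat.cast_eq_zero] at hsg
  exact hsg.resolve_left hn.ne'
end AB

open Module TensorProduct
section Z
universe u v
open Polynomial

lemma charZero_of (K : Type u) [Field K] (hK : NumberField K ∨ IsRealClosedField K) : CharZero K := by
  rcases hK with hK | hK
  · exact hK.to_charZero
  · obtain ⟨p, hp⟩ := CharP.exists K
    rcases Nat.eq_zero_or_pos p with rfl | hp0
    · exact CharP.charP_to_charZero K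
    · exfalso
      apply hK.1
      have h : ∀ n : ℕ, IsSquare (n : K) := by
        intro n
        induction n with
        | zero => simp
        | succ k ih => push_cast; exact hK.2.2.1 _ _ ih (by simp)
      have h1 := h (p - 1)
      have h2 : ((p - 1 : ℕ) : K) = -1 := by
        rw [Nat.cast_sub hp0, CharP.cast_eq_zero]; simp
      rwa [h2] at h1

variable {K : Type u} [Field K] {V : Type v} [AddCommGroup V] [Module K V] [FiniteDimensional K V]

lemma nonsing_comb [CharZero K] (q₁ q₂ : LinearMap.BilinForm K V) (hns : IsNonsingularSystem ![q₁, q₂]) :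
    ∃ a b : K, a ≠ 0 ∧ (a • q₁ + b • q₂).Nondegenerate := by
  classical
  obtain ⟨L, iL, iA, B, hB, hBn⟩ := hns
  let ι := Fin (finrank K V)
  let b : Basis ι K V := Module.finBasis K V
  let bL : Basis ι L (L ⊗[K] V) := b.baseChange L
  rw [LinearMap.BilinForm.nondegenerate_iff_det_ne_zero bL] at hBn
  obtain ⟨α, β, hαβ⟩ : ∃ α β : L, α • q₁.baseChange L + β • q₂.baseChange L = B := by
    have : (Set.range fun i => LinearMap.BilinForm.baseChange L (![q₁, q₂] i)) = {q₁.baseChange L, q₂.baseChange L} := by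
      ext x
      simp [Fin.exists_fin_two, eq_comm]
    rw [this, Submodule.mem_span_pair] at hB
    exact hB
  let A₁ := LinearMap.BilinForm.toMatrix b q₁
  let A₂ := LinearMap.BilinForm.toMatrix b q₂
  let M : Matrix ι ι (MvPolynomial (Fin 2) K) :=
    Matrix.of fun i j => MvPolynomial.X 0 * MvPolynomial.C (A₁ i j) + MvPolynomial.X 1 * MvPolynomial.C (A₂ i j)
  have hd : M.det ≠ 0 := by
    intro h0
    apply hBn
    have h1 : LinearMap.BilinForm.toMatrix bL B = (MvPolynomial.aeval ![α, β] : _ →ₐ[K] L).mapMatrix M := by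
      ext i j
      rw [← hαβ]
      simp [M, A₁, A₂, bL, LinearMap.BilinForm.toMatrix_apply, Algebra.smul_def]
    rw [h1, ← AlgHom.map_det, h0, map_zero]
  have hd2 : M.det * MvPolynomial.X 0 ≠ 0 := mul_ne_zero hd (MvPolynomial.X_ne_zero 0)
  obtain ⟨x, hx⟩ : ∃ x : Fin 2 → K, MvPolynomial.eval x (M.det * MvPolynomial.X 0) ≠ 0 := by
    by_contra! hcon
    exact hd2 (MvPolynomial.funext fun x => by rw [hcon x, map_zero])
  rw [map_mul, MvPolynomial.eval_X] at hx
  refine ⟨x 0, x 1, right_ne_zero_of_mul hx, ?_⟩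
  rw [LinearMap.BilinForm.nondegenerate_iff_det_ne_zero b]
  have h1 : LinearMap.BilinForm.toMatrix b (x 0 • q₁ + x 1 • q₂) = (MvPolynomial.eval x).mapMatrix M := by
    ext i j
    simp [M, A₁, A₂, LinearMap.BilinForm.toMatrix_apply]
  rw [h1, ← RingHom.map_det]
  exact left_ne_zero_of_mul hx

theorem b_to_a (hK : NumberField K ∨ IsRealClosedField K) (q₁ q₂ : LinearMap.BilinForm K V) (h₁ : q₁.IsSymm) (h₂ : q₂.IsSymm)
    (hns : IsNonsingularSystem ![q₁, q₂])
    (hb : ∀ W : LinearMap.BilinForm K V, W.IsSymm →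
        (∀ φ ψ : Module.End K V,
          (∀ x y : V, q₁ (ψ x) y = q₁ x (φ y)) →
          (∀ x y : V, q₂ (ψ x) y = q₂ x (φ y)) →
          ∀ x y : V, W (ψ x) y = W x (φ y)) →
        ∀ O : FieldOrdering K, signatureAt O (fun v => W v v) = 0) :
    ∃ n : ℕ, 0 < n ∧
        IsHyperbolicSystem fun i : Fin 2 => timesQ n fun v => ![q₁, q₂] i v v := by
  haveI := charZero_of K hK
  obtain ⟨a, b, ha, hn⟩ := nonsing_comb q₁ q₂ hns
  obtain ⟨q, hq⟩ : ∃ q, q = a • q₁ + b • q₂ := ⟨_, rfl⟩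
  rw [← hq] at hn
  have hqa : ∀ x y, q x y = a * q₁ x y + b * q₂ x y := fun x y => by rw [hq]; simp
  have e1 : ∀ x y, q₁ x y = q₁ y x := fun x y => h₁.eq x y
  have e2 : ∀ x y, q₂ x y = q₂ y x := fun x y => h₂.eq x y
  have hs : q.IsSymm := ⟨fun x y => by
    rw [hqa, hqa, e1, e2]⟩
  have es : ∀ x y, q x y = q y x := fun x y => hs.eq x y
  let T : Module.End K V := q₂.symmCompOfNondegenerate q hn
  have hT2 : ∀ x y, q (T x) y = q₂ x y := fun x y => by
    rw [LinearMap.BilinForm.comp_symmCompOfNondegenerate_apply]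
  have hT : ∀ x y, q (T x) y = q x (T y) := fun x y => by
    rw [es x, hT2, hT2, e2]
  have hcl : ∀ (O : FieldOrdering K) (F : K[X]), signatureAt O (fun x => q (aeval T F x) x) = 0 := by
    intro O F
    refine hb (q.compLeft (aeval T F)) ⟨fun x y => ?_⟩ ?_ O
    · simp only [RingHom.id_apply, LinearMap.BilinForm.compLeft_apply]
      rw [sa_aeval q T hT, es]
    · intro φ ψ hψ1 hψ2 x y
      simp only [LinearMap.BilinForm.compLeft_apply]
      have hψ : ∀ x y, q (ψ x) y = q x (φ y) := fun x y => by rw [hqa, hqa, hψ1, hψ2]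
      have hinj : ∀ u v : V, (∀ y, q u y = q v y) → u = v := by
        intro u v huv
        have h0 : ∀ y, q (u - v) y = 0 := fun y => by rw [map_sub, LinearMap.sub_apply, huv, sub_self]
        exact sub_eq_zero.1 (hn.1 _ h0)
      have hc : Commute T ψ := by
        ext x
        apply hinj
        intro y
        simp only [Module.End.mul_apply]
        rw [hT2, hψ2, hψ, hT2]
      have hcF : Commute (aeval T F) ψ := by
        induction F using Polynomial.induction_on' with
        | add p r hp hr => rw [map_add]; exact hp.add_left hr
        | monomial n c =>
          rw [aeval_monomial]
          exact Commute.mul_left (Algebra.commutes c ψ) (hc.pow_left n)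
      have h3 : aeval T F (ψ x) = ψ (aeval T F x) := congrArg (fun f : Module.End K V => f x) hcF.eq
      rw [h3, hψ]
  obtain ⟨C, iC, κ, hκ, I, iI, w, s0, ι, e, hw, heT, hqq, hsig⟩ := nform q hs hn T hT
  have hz : ∀ c, ∀ O : FieldOrdering (LL (κ c)), ∑ i, osgn O (w c i) = 0 := fun c O =>
    sep_all (K := K) hK (w c) (hw c)
      (fun O g hg => sig_extract hκ q T w s0 ι e hw heT hqq hsig O (hcl O) c g hg) O
  obtain ⟨N, hN, U, W, hUW, hU, hW⟩ := hyp_build q T w s0 ι e hw heT hqq hz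
  have hfin : ∀ x : Fin N → V, (∑ r, q (x r) (x r) = 0 ∧ ∑ r, q (T (x r)) (x r) = 0) →
      ∀ i : Fin 2, timesQ N (fun v => ![q₁, q₂] i v v) x = 0 := by
    rintro x ⟨hx1, hx2⟩
    simp only [hT2] at hx2
    simp only [hqa, Finset.sum_add_distrib, ← Finset.mul_sum, hx2, mul_zero, add_zero] at hx1
    have hx3 := (mul_eq_zero.1 hx1).resolve_left ha
    intro i
    fin_cases i
    · exact hx3
    · exact hx2
  exact ⟨N, hN, U, W, hUW, fun i x hx => hfin x (hU x hx) i, fun i x hx => hfin x (hW x hx) i⟩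
end Z

/-- **Theorem B.** Let `K` be a number field or a real closed field and `{q₁, q₂}` a
nonsingular pair of quadratic forms on a finite-dimensional `K`-vector space. Then
`n × {q₁, q₂}` is hyperbolic for some `n ≥ 1` iff every form in the closure `Cl{q₁, q₂}`
has total signature `0`. -/
theorem statement1 {K : Type u} {V : Type v} [Field K]
    (hK : NumberField K ∨ IsRealClosedField K)
    [AddCommGroup V] [Module K V] [FiniteDimensional K V]
    (q₁ q₂ : LinearMap.BilinForm K V) (h₁ : q₁.IsSymm) (h₂ : q₂.IsSymm)
    (hns : IsNonsingularSystem ![q₁, q₂]) :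
    (∃ n : ℕ, 0 < n ∧
        IsHyperbolicSystem fun i : Fin 2 => timesQ n fun v => ![q₁, q₂] i v v) ↔
      ∀ W : LinearMap.BilinForm K V, W.IsSymm →
        (∀ φ ψ : Module.End K V,
          (∀ x y : V, q₁ (ψ x) y = q₁ x (φ y)) →
          (∀ x y : V, q₂ (ψ x) y = q₂ x (φ y)) →
          ∀ x y : V, W (ψ x) y = W x (φ y)) →
        ∀ O : FieldOrdering K, signatureAt O (fun v => W v v) = 0 := by
  constructor
  · rintro ⟨n, hn, hyp⟩ W hW hcl O
    exact a_to_b q₁ q₂ h₁ h₂ n hn hyp W hW hcl O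
  · exact b_to_a hK q₁ q₂ h₁ h₂ hns
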